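/- arXiv:math/0701718 — 2 statements merged into one kernel-verified Lean document; each statement's English description precedes it below -/
import Mathlib

section
/- Let 0 < α < 1 and let ℓ be slowly varying at ∞. Then the following are equivalent: (a) ν̄(x) ~ ℓ(1/x) x^{−α} as x → 0+; (b) Φ(t) ~ Γ(1−α) t^α ℓ(t) as t → ∞; (c) Φ_1(t) ~ α Γ(1−α) t^α ℓ(t) as t → ∞. Moreover, each of these implies that for every integer r ≥ 1, Φ_r(t) ~ (α Γ(r−α)/r!) t^α ℓ(t) as t → ∞. -/
open Filter Topology

/-- Tail counting function `ν̄(x) = #{j : p_j ≥ x}`, as a real number. -/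
noncomputable def nubar (p : ℕ → ℝ) (x : ℝ) : ℝ := ({j | x ≤ p j}.ncard : ℝ)

/-- Poissonized expected number of occupied boxes. -/
noncomputable def Phi (p : ℕ → ℝ) (t : ℝ) : ℝ := ∑' j, (1 - Real.exp (-t * p j))

/-- Poissonized expected number of boxes occupied by exactly `r` balls:
`Φ_r(t) = (t^r / r!) ∑_j p_j^r e^{-t p_j}`. -/
noncomputable def PhiR (p : ℕ → ℝ) (r : ℕ) (t : ℝ) : ℝ :=
  t ^ r / (Nat.factorial r) * ∑' j, p j ^ r * Real.exp (-t * p j)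

/-- A function `ℓ : (0,∞) → (0,∞)` is slowly varying at `∞` if
`ℓ(cy)/ℓ(y) → 1` as `y → ∞` for every `c > 0`. -/
def SlowlyVarying (ℓ : ℝ → ℝ) : Prop :=
  ∀ c : ℝ, 0 < c → Tendsto (fun y : ℝ => ℓ (c * y) / ℓ y) atTop (𝓝 1)


lemma s17_potter (N : ℝ → ℝ) (X γ : ℝ) (hγ : 0 ≤ γ) (hN : ∀ x, 0 < x → 0 ≤ N x)
    (anti : ∀ x y, 0 < x → x ≤ y → N y ≤ N x)
    (h : ∀ x, 0 < x → x ≤ X → N (x / 2) ≤ 2 ^ γ * N x) (v x : ℝ) (hv : 0 < v) (hv1 : v ≤ 1)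
    (hx : 0 < x) (hxX : x ≤ X) : N (v * x) ≤ 2 ^ γ * v ^ (-γ) * N x := by
  have key : ∀ n : ℕ, N (x / 2 ^ n) ≤ ((2 : ℝ) ^ γ) ^ n * N x := by
    intro n
    induction n with
    | zero => simp
    | succ n ih =>
      have h1 := h (x / 2 ^ n) (by positivity)
        ((div_le_self hx.le (one_le_pow₀ (by norm_num))).trans hxX)
      have h2 : x / 2 ^ (n + 1) = x / 2 ^ n / 2 := by rw [pow_succ]; field_simp
      rw [h2]
      calc _ ≤ _ := h1
        _ ≤ 2 ^ γ * (((2 : ℝ) ^ γ) ^ n * N x) := by gcongr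
        _ = _ := by ring
  obtain ⟨n, hn1, hn2⟩ := exists_nat_pow_near_of_lt_one hv hv1 (y := (1 / 2 : ℝ)) (by norm_num)
    (by norm_num)
  have h3 : N (v * x) ≤ N (x / 2 ^ (n + 1)) := by
    apply anti _ _ (by positivity)
    have : x / 2 ^ (n + 1) = (1 / 2) ^ (n + 1) * x := by
      rw [one_div, inv_pow]; field_simp
    rw [this]; gcongr
  have h4 : ((2 : ℝ) ^ γ) ^ n ≤ v ^ (-γ) := by
    rw [← Real.rpow_natCast, ← Real.rpow_mul (by norm_num), mul_comm, Real.rpow_mul (by norm_num),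
      Real.rpow_natCast, Real.rpow_neg hv.le, ← Real.inv_rpow hv.le]
    apply Real.rpow_le_rpow (by positivity) _ hγ
    rw [le_inv_comm₀ (by positivity) hv]
    simpa using hn2
  calc _ ≤ _ := h3
    _ ≤ _ := key (n + 1)
    _ = 2 ^ γ * ((2 : ℝ) ^ γ) ^ n * N x := by ring
    _ ≤ _ := by
      have := hN x hx
      gcongr

lemma s17_summable {p : ℕ → ℝ} (hsum : ∑' j, p j = 1) : Summable p := by
  by_contra h
  rw [tsum_eq_zero_of_not_summable h] at hsum
  norm_num at hsum

lemma s17_fin {p : ℕ → ℝ} (hs : Summable p) {x : ℝ} (hx : 0 < x) : {j | x ≤ p j}.Finite := by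
  have h := hs.tendsto_cofinite_zero.eventually (gt_mem_nhds hx)
  rw [Filter.eventually_cofinite] at h
  simpa using h

lemma s17_nubar_hasSum {p : ℕ → ℝ} (hs : Summable p) {x : ℝ} (hx : 0 < x) :
    HasSum (fun j => if x ≤ p j then (1 : ℝ) else 0) (nubar p x) := by
  have hf := s17_fin hs hx
  have h := hasSum_sum_of_ne_finset_zero (f := fun j => if x ≤ p j then (1 : ℝ) else 0)
    (s := hf.toFinset) (L := SummationFilter.unconditional ℕ) (by
      intro b hb
      simp only [Set.Finite.mem_toFinset, Set.mem_ofPred_eq] at hb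
      simp [hb])
  convert h using 1
  rw [nubar, Set.ncard_eq_toFinset_card _ hf, Finset.card_eq_sum_ones]
  push_cast
  apply Finset.sum_congr rfl
  intro j hj
  simp only [Set.Finite.mem_toFinset, Set.mem_ofPred_eq] at hj
  simp [hj]

lemma s17_nubar_anti {p : ℕ → ℝ} (hs : Summable p) (x y : ℝ) (hx : 0 < x) (hxy : x ≤ y) :
    nubar p y ≤ nubar p x := by
  unfold nubar
  exact_mod_cast Set.ncard_le_ncard (fun j (hj : y ≤ p j) => hxy.trans hj) (s17_fin hs hx)

lemma s17_nubar_nonneg {p : ℕ → ℝ} (x : ℝ) : 0 ≤ nubar p x := by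
  unfold nubar; positivity

open MeasureTheory in
lemma s17_rep {p : ℕ → ℝ} (hpos : ∀ j, 0 < p j) (hs : Summable p) (k : ℝ → ℝ) (C : ℝ)
    (hk : Continuous k) (hC : ∀ v, 0 < v → |k v| ≤ C) (t : ℝ) (ht : 0 < t) :
    ∑' j, (∫ v in (0)..(t * p j), k v) = ∫ v in Set.Ioi (0 : ℝ), nubar p (v / t) * k v := by
  have hset : ∀ j, Set.Ioc 0 (t * p j) ⊆ Set.Ioi (0 : ℝ) := fun j => Set.Ioc_subset_Ioi_self
  have hI : ∀ j (f : ℝ → ℝ), ∫ v in Set.Ioi (0 : ℝ), (Set.Ioc 0 (t * p j)).indicator f v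
      = ∫ v in Set.Ioc 0 (t * p j), f v := by
    intro j f
    rw [MeasureTheory.setIntegral_indicator measurableSet_Ioc, Set.inter_eq_right.2 (hset j)]
  have h := hasSum_integral_of_summable_integral_norm (μ := volume.restrict (Set.Ioi (0 : ℝ)))
    (F := fun j => (Set.Ioc 0 (t * p j)).indicator k) (by
      intro j
      rw [integrable_indicator_iff measurableSet_Ioc]
      exact (hk.integrableOn_Ioc).mono_measure Measure.restrict_le_self) (by
      apply Summable.of_nonneg_of_le (f := fun j => C * (t * p j))
      · intro j; positivity
      · intro j
        simp_rw [norm_indicator_eq_indicator_norm]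
        rw [hI]
        have := norm_setIntegral_le_of_norm_le_const (μ := volume) (s := Set.Ioc 0 (t * p j))
          (f := fun v => ‖k v‖) (C := C) (by simp) (by
            intro v hv; simpa using hC v hv.1)
        have h2 := mul_pos ht (hpos j)
        refine (le_abs_self _).trans (this.trans ?_)
        simp [Measure.real, h2.le]
      · exact (hs.mul_left t).mul_left C)
  have e1 : ∀ j, ∫ v in (0)..(t * p j), k v
      = ∫ v in Set.Ioi (0 : ℝ), (Set.Ioc 0 (t * p j)).indicator k v := by
    intro j
    rw [hI, intervalIntegral.integral_of_le (mul_pos ht (hpos j)).le]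
  simp_rw [e1]
  rw [h.tsum_eq]
  apply setIntegral_congr_fun measurableSet_Ioi
  intro v hv
  simp only [Set.mem_Ioi] at hv
  have := (s17_nubar_hasSum hs (div_pos hv ht)).mul_right (k v)
  simp only
  rw [← this.tsum_eq]
  apply tsum_congr
  intro j
  by_cases hh : v / t ≤ p j
  · have : v ≤ t * p j := by rwa [div_le_iff₀' ht] at hh
    simp [Set.indicator, hh, this, hv]
  · have : ¬ v ≤ t * p j := by rwa [div_le_iff₀' ht] at hh
    simp [Set.indicator, hh, this]

open MeasureTheory in
lemma s17_abel {p : ℕ → ℝ} (hpos : ∀ j, 0 < p j) (hs : Summable p) (α : ℝ) (hα0 : 0 < α)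
    (hα1 : α < 1) (g : ℝ → ℝ) (hgpos : ∀ t, 0 < t → 0 < g t)
    (hg : ∀ c, 0 < c → Tendsto (fun t => g (c * t) / g t) atTop (𝓝 (c ^ α)))
    (ha : Tendsto (fun t => nubar p (1 / t) / g t) atTop (𝓝 1))
    (k : ℝ → ℝ) (C : ℝ)
    (hk : Continuous k) (hC : ∀ v, 0 < v → |k v| ≤ C)
    (hint : ∀ b : ℝ, 0 ≤ b → b < 1 → IntegrableOn (fun v => v ^ (-b) * k v) (Set.Ioi 0)) :
    Tendsto (fun t => (∑' j, (∫ v in (0)..(t * p j), k v)) / g t) atTop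
      (𝓝 (∫ v in Set.Ioi (0 : ℝ), v ^ (-α) * k v)) := by
  obtain ⟨β, hb0, hb1⟩ := exists_between hα1
  have hβ0 : 0 < β := hα0.trans hb0
  have lim : ∀ v, 0 < v → Tendsto (fun t => nubar p (v / t) / g t) atTop (𝓝 (v ^ (-α))) := by
    intro v hv
    have hv' : 0 < v⁻¹ := inv_pos.2 hv
    have h1 := (ha.comp (tendsto_id.const_mul_atTop hv')).mul (hg v⁻¹ hv')
    rw [one_mul, Real.inv_rpow hv.le, ← Real.rpow_neg hv.le] at h1
    refine h1.congr' ?_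
    filter_upwards [eventually_gt_atTop 0] with t ht
    have : g (v⁻¹ * t) ≠ 0 := (hgpos _ (by positivity)).ne'
    have h2 : 1 / (v⁻¹ * t) = v / t := by field_simp
    simp only [Function.comp, id]
    rw [h2]; exact div_mul_div_cancel₀ this
  have hr : ∀ᶠ t in atTop, nubar p (1 / t / 2) ≤ 2 ^ β * nubar p (1 / t) := by
    have h1 := (lim (1 / 2) (by norm_num)).div ha one_ne_zero
    have h2 : ((1 / 2 : ℝ)) ^ (-α) / 1 < 2 ^ β := by
      rw [div_one, Real.rpow_neg (by norm_num), ← Real.inv_rpow (by norm_num)]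
      norm_num
      exact hb0
    filter_upwards [h1.eventually (gt_mem_nhds h2), ha.eventually (lt_mem_nhds one_pos),
      eventually_gt_atTop 0] with t h3 h4 ht
    have h5 := hgpos t ht
    have h6 : 0 < nubar p (1 / t) := by
      by_contra hh
      have := div_nonpos_of_nonpos_of_nonneg (not_lt.1 hh) h5.le
      linarith
    simp only [Pi.div_apply] at h3
    rw [div_div_div_cancel_right₀ h5.ne', div_lt_iff₀ h6] at h3
    have h7 : 1 / t / 2 = 1 / 2 / t := by ring
    rw [h7]; exact h3.le
  obtain ⟨T, hT⟩ := eventually_atTop.1 (hr.and (eventually_gt_atTop 0))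
  have hT0 : 0 < T := (hT T le_rfl).2
  have pot : ∀ t, T ≤ t → ∀ v, 0 < v → v ≤ 1 →
      nubar p (v / t) ≤ 2 ^ β * v ^ (-β) * nubar p (1 / t) := by
    intro t ht v hv hv1
    have ht0 : 0 < t := hT0.trans_le ht
    have := s17_potter (nubar p) (1 / T) β hβ0.le (fun x _ => s17_nubar_nonneg x)
      (fun x y => s17_nubar_anti hs x y) (by
        intro x hx hxT
        have h1 : T ≤ 1 / x := by rwa [le_one_div hT0 hx]
        have := (hT (1 / x) h1).1
        simpa using this) v (1 / t) hv hv1 (by positivity)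
        (one_div_le_one_div_of_le hT0 ht)
    rwa [mul_one_div] at this
  have h2g : ∀ᶠ t in atTop, nubar p (1 / t) ≤ 2 * g t := by
    filter_upwards [ha.eventually (gt_mem_nhds one_lt_two), eventually_gt_atTop 0] with t h ht
    exact ((div_lt_iff₀ (hgpos t ht)).1 h).le
  have main : Tendsto (fun t => ∫ v in Set.Ioi (0 : ℝ), nubar p (v / t) / g t * k v) atTop
      (𝓝 (∫ v in Set.Ioi (0 : ℝ), v ^ (-α) * k v)) := by
    apply tendsto_integral_filter_of_dominated_convergence
      (fun v => 2 * 2 ^ β * |v ^ (-β) * k v| + 2 * |v ^ (-(0 : ℝ)) * k v|)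
    · filter_upwards [eventually_gt_atTop 0] with t ht
      apply AEStronglyMeasurable.mul _ hk.aestronglyMeasurable
      apply AEMeasurable.aestronglyMeasurable
      apply AEMeasurable.div_const
      apply aemeasurable_restrict_of_antitoneOn measurableSet_Ioi
      intro x hx y hy hxy
      exact s17_nubar_anti hs _ _ (div_pos hx ht) (by gcongr)
    · filter_upwards [h2g, eventually_ge_atTop T] with t h2 htT
      have ht : 0 < t := hT0.trans_le htT
      rw [ae_restrict_iff' measurableSet_Ioi]
      refine Eventually.of_forall fun v hv => ?_
      simp only [Set.mem_Ioi] at hv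
      have hgt := hgpos t ht
      have hvb : 0 < v ^ (-β) := Real.rpow_pos_of_pos hv _
      have B : nubar p (v / t) / g t ≤ 2 * 2 ^ β * v ^ (-β) + 2 := by
        rw [div_le_iff₀ hgt]
        have h2b : 0 < (2 : ℝ) ^ β := by positivity
        rcases le_total v 1 with h1 | h1
        · calc _ ≤ _ := pot t htT v hv h1
            _ ≤ 2 ^ β * v ^ (-β) * (2 * g t) := by gcongr
            _ ≤ _ := by nlinarith
        · calc _ ≤ nubar p (1 / t) := s17_nubar_anti hs _ _ (by positivity) (by gcongr)
            _ ≤ _ := h2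
            _ ≤ _ := by
              have : 0 < 2 ^ β * v ^ (-β) * g t := by positivity
              nlinarith
      rw [norm_mul, Real.norm_eq_abs, Real.norm_eq_abs,
        abs_of_nonneg (div_nonneg (s17_nubar_nonneg _) hgt.le), abs_mul, abs_mul,
        abs_of_pos hvb, neg_zero, Real.rpow_zero, abs_one]
      calc _ ≤ (2 * 2 ^ β * v ^ (-β) + 2) * |k v| := by gcongr
        _ = _ := by ring
    · exact ((hint β hβ0.le hb1).abs.const_mul _).add ((hint 0 le_rfl one_pos).abs.const_mul _)
    · rw [ae_restrict_iff' measurableSet_Ioi]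
      exact Eventually.of_forall fun v hv => (lim v hv).mul_const _
  refine main.congr' ?_
  filter_upwards [eventually_gt_atTop 0] with t ht
  rw [s17_rep hpos hs k C hk hC t ht, ← integral_div]
  congr 1
  ext v
  ring

open MeasureTheory in
lemma s17_gint (b : ℝ) (hb : b < 1) (m : ℕ) :
    IntegrableOn (fun v : ℝ => v ^ (-b) * (Real.exp (-v) * v ^ m)) (Set.Ioi 0) ∧
    ∫ v in Set.Ioi (0 : ℝ), v ^ (-b) * (Real.exp (-v) * v ^ m) = Real.Gamma (m + 1 - b) := by
  have hm : (0 : ℝ) ≤ m := Nat.cast_nonneg m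
  have e : ∀ v ∈ Set.Ioi (0 : ℝ), v ^ (-b) * (Real.exp (-v) * v ^ m)
      = Real.exp (-v) * v ^ ((m + 1 - b : ℝ) - 1) := by
    intro v hv
    have : ((m : ℝ) + 1 - b) - 1 = -b + m := by ring
    rw [this, Real.rpow_add hv, Real.rpow_natCast]; ring
  constructor
  · rw [integrableOn_congr_fun e measurableSet_Ioi]
    exact Real.GammaIntegral_convergent (by linarith)
  · rw [setIntegral_congr_fun measurableSet_Ioi e, Real.Gamma_eq_integral (by linarith)]

lemma s17_ab {p : ℕ → ℝ} (hpos : ∀ j, 0 < p j) (hs : Summable p) (α : ℝ) (hα0 : 0 < α)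
    (hα1 : α < 1) (g : ℝ → ℝ) (hgpos : ∀ t, 0 < t → 0 < g t)
    (hg : ∀ c, 0 < c → Tendsto (fun t => g (c * t) / g t) atTop (𝓝 (c ^ α)))
    (ha : Tendsto (fun t => nubar p (1 / t) / g t) atTop (𝓝 1)) :
    Tendsto (fun t => Phi p t / g t) atTop (𝓝 (Real.Gamma (1 - α))) := by
  have h := s17_abel hpos hs α hα0 hα1 g hgpos hg ha (fun v => Real.exp (-v)) 1 (by fun_prop) (by
    intro v hv
    rw [abs_of_pos (Real.exp_pos _)]
    exact Real.exp_le_one_iff.2 (by linarith)) (by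
    intro b _ hb
    simpa using (s17_gint b hb 0).1)
  have h2 := (s17_gint α hα1 0).2
  simp only [pow_zero, mul_one, Nat.cast_zero, zero_add] at h2
  rw [h2] at h
  refine h.congr fun t => ?_
  congr 1
  unfold Phi
  apply tsum_congr
  intro j
  rw [intervalIntegral.integral_eq_sub_of_hasDerivAt (f := fun v => - Real.exp (-v))]
  · simp; ring
  · intro x _
    have := (((hasDerivAt_id x).neg).exp).neg
    refine this.congr_deriv ?_
    simp
  · exact Continuous.intervalIntegrable (by fun_prop) _ _

lemma s17_ar {p : ℕ → ℝ} (hpos : ∀ j, 0 < p j) (hs : Summable p) (α : ℝ) (hα0 : 0 < α)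
    (hα1 : α < 1) (g : ℝ → ℝ) (hgpos : ∀ t, 0 < t → 0 < g t)
    (hg : ∀ c, 0 < c → Tendsto (fun t => g (c * t) / g t) atTop (𝓝 (c ^ α)))
    (ha : Tendsto (fun t => nubar p (1 / t) / g t) atTop (𝓝 1)) (m : ℕ) :
    Tendsto (fun t => PhiR p (m + 1) t / g t) atTop
      (𝓝 (α * Real.Gamma (((m + 1 : ℕ) : ℝ) - α) / (Nat.factorial (m + 1)))) := by
  have hm : (0 : ℝ) ≤ m := Nat.cast_nonneg m
  have hf1 : (0 : ℝ) < Nat.factorial m := by exact_mod_cast Nat.factorial_pos m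
  have hf2 : (0 : ℝ) < Nat.factorial (m + 1) := by exact_mod_cast Nat.factorial_pos (m + 1)
  have hf3 : (Nat.factorial (m + 1) : ℝ) = (m + 1) * Nat.factorial m := by
    rw [Nat.factorial_succ]; push_cast; ring
  have split : ∀ b v : ℝ, v ^ (-b) * (Real.exp (-v) * (v ^ m / m.factorial
        - v ^ (m + 1) / (m + 1).factorial))
      = (1 / (m.factorial : ℝ)) * (v ^ (-b) * (Real.exp (-v) * v ^ m))
        - (1 / ((m + 1).factorial : ℝ)) * (v ^ (-b) * (Real.exp (-v) * v ^ (m + 1))) := by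
    intro b v; ring
  have h := s17_abel hpos hs α hα0 hα1 g hgpos hg ha
    (fun v => Real.exp (-v) * (v ^ m / m.factorial - v ^ (m + 1) / (m + 1).factorial)) 2
    (by fun_prop) (by
    intro v hv
    have b1 := Real.pow_div_factorial_le_exp v hv.le m
    have b2 := Real.pow_div_factorial_le_exp v hv.le (m + 1)
    have p1 : 0 ≤ v ^ m / (m.factorial : ℝ) := by positivity
    have p2 : 0 ≤ v ^ (m + 1) / ((m + 1).factorial : ℝ) := by positivity
    rw [abs_mul, abs_of_pos (Real.exp_pos _)]
    have b3 : |v ^ m / (m.factorial : ℝ) - v ^ (m + 1) / ((m + 1).factorial : ℝ)|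
        ≤ 2 * Real.exp v := by
      rw [abs_le]; constructor <;> linarith
    calc _ ≤ Real.exp (-v) * (2 * Real.exp v) := by gcongr
      _ = 2 * (Real.exp (-v) * Real.exp v) := by ring
      _ ≤ _ := by rw [← Real.exp_add]; simp) (by
    intro b _ hb
    simp_rw [split]
    exact ((s17_gint b hb m).1.const_mul _).sub ((s17_gint b hb (m + 1)).1.const_mul _))
  simp_rw [split] at h
  rw [MeasureTheory.integral_sub ((s17_gint α hα1 m).1.const_mul _)
    ((s17_gint α hα1 (m + 1)).1.const_mul _), MeasureTheory.integral_const_mul,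
    MeasureTheory.integral_const_mul, (s17_gint α hα1 m).2, (s17_gint α hα1 (m + 1)).2] at h
  have hG : Real.Gamma (((m + 1 : ℕ) : ℝ) + 1 - α) = (m + 1 - α) * Real.Gamma (m + 1 - α) := by
    have : (((m + 1 : ℕ) : ℝ) + 1 - α) = (m + 1 - α) + 1 := by push_cast; ring
    rw [this, Real.Gamma_add_one (by linarith)]
  have hval : 1 / (m.factorial : ℝ) * Real.Gamma (m + 1 - α)
      - 1 / ((m + 1).factorial : ℝ) * Real.Gamma (((m + 1 : ℕ) : ℝ) + 1 - α)
      = α * Real.Gamma (((m + 1 : ℕ) : ℝ) - α) / (Nat.factorial (m + 1)) := by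
    rw [hG, hf3]; push_cast; field_simp; ring
  rw [hval] at h
  refine h.congr fun t => ?_
  congr 1
  unfold PhiR
  rw [← tsum_mul_left]
  apply tsum_congr
  intro j
  rw [intervalIntegral.integral_eq_sub_of_hasDerivAt
    (f := fun v => Real.exp (-v) * (v ^ (m + 1) / (m + 1).factorial))]
  · simp; ring
  · intro x _
    have := (((hasDerivAt_id x).neg).exp).mul
      ((hasDerivAt_pow (m + 1) x).div_const ((m + 1).factorial : ℝ))
    refine this.congr_deriv ?_
    simp only [id, Nat.add_sub_cancel, Pi.neg_apply]
    rw [hf3]; push_cast; field_simp; ring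
  · exact Continuous.intervalIntegrable (by fun_prop) _ _

lemma s17_Dsum {p : ℕ → ℝ} (hpos : ∀ j, 0 < p j) (hs : Summable p) (t : ℝ) (ht : 0 ≤ t) :
    Summable (fun j => p j * Real.exp (-t * p j)) := by
  apply Summable.of_nonneg_of_le (f := p) _ _ hs
  · intro j; have := hpos j; positivity
  · intro j
    have := hpos j
    have h : Real.exp (-t * p j) ≤ 1 := Real.exp_le_one_iff.2 (by nlinarith)
    nlinarith

open MeasureTheory in
lemma s17_rep2 {p : ℕ → ℝ} (hpos : ∀ j, 0 < p j) (hs : Summable p) (t : ℝ) (ht : 0 < t) :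
    Phi p t = t * ∫ s in Set.Ioc (0 : ℝ) 1, ∑' j, p j * Real.exp (-(s * t) * p j) := by
  have hi : ∀ j, IntegrableOn (fun s => p j * Real.exp (-(s * t) * p j)) (Set.Ioc (0 : ℝ) 1) := by
    intro j
    exact Continuous.integrableOn_Ioc (by fun_prop)
  have h := hasSum_integral_of_summable_integral_norm (μ := volume.restrict (Set.Ioc (0 : ℝ) 1))
    (F := fun j s => p j * Real.exp (-(s * t) * p j)) hi (by
      apply Summable.of_nonneg_of_le (f := p) _ _ hs
      · intro j; positivity
      · intro j
        have := norm_setIntegral_le_of_norm_le_const (μ := volume) (s := Set.Ioc (0 : ℝ) 1)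
          (f := fun s => ‖p j * Real.exp (-(s * t) * p j)‖) (C := p j) (by simp) (by
            intro s hs
            have hp := hpos j
            have h0 : 0 ≤ s * t * p j := by have := hs.1; positivity
            have h1 : Real.exp (-(s * t) * p j) ≤ 1 := Real.exp_le_one_iff.2 (by linarith)
            rw [norm_norm, Real.norm_eq_abs, abs_of_pos (by positivity)]
            nlinarith)
        refine (le_abs_self _).trans (this.trans ?_)
        simp [Measure.real])
  rw [← h.tsum_eq, ← tsum_mul_left]
  unfold Phi
  apply tsum_congr
  intro j
  rw [← intervalIntegral.integral_of_le zero_le_one, ← intervalIntegral.integral_const_mul]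
  rw [intervalIntegral.integral_eq_sub_of_hasDerivAt
    (f := fun s => - Real.exp (-(s * t) * p j))]
  · simp; ring
  · intro x _
    have := (((((hasDerivAt_id x).mul_const t).neg).mul_const (p j)).exp).neg
    refine this.congr_deriv ?_
    simp; ring
  · exact Continuous.intervalIntegrable (by fun_prop) _ _

open MeasureTheory in
lemma s17_cb {p : ℕ → ℝ} (hpos : ∀ j, 0 < p j) (hsum : ∑' j, p j = 1) (α : ℝ) (hα0 : 0 < α)
    (hα1 : α < 1) (g : ℝ → ℝ) (hgpos : ∀ t, 0 < t → 0 < g t)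
    (hg : ∀ c, 0 < c → Tendsto (fun t => g (c * t) / g t) atTop (𝓝 (c ^ α)))
    (hc : Tendsto (fun t => PhiR p 1 t / g t) atTop (𝓝 (α * Real.Gamma (1 - α)))) :
    Tendsto (fun t => Phi p t / g t) atTop (𝓝 (Real.Gamma (1 - α))) := by
  have hs := s17_summable hsum
  have hG : 0 < Real.Gamma (1 - α) := Real.Gamma_pos_of_pos (by linarith)
  have hK : 0 < α * Real.Gamma (1 - α) := by positivity
  set D : ℝ → ℝ := fun t => ∑' j, p j * Real.exp (-t * p j) with hD
  have hPD : ∀ t, PhiR p 1 t = t * D t := by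
    intro t; simp [PhiR, hD]
  have Dpos : ∀ t, 0 ≤ t → 0 < D t := fun t ht =>
    (s17_Dsum hpos hs t ht).tsum_pos (fun j => by have := hpos j; positivity) 0
      (by have := hpos 0; positivity)
  have Danti : ∀ x y, 0 ≤ x → x ≤ y → D y ≤ D x := by
    intro x y hx hxy
    apply (s17_Dsum hpos hs y (hx.trans hxy)).tsum_le_tsum _ (s17_Dsum hpos hs x hx)
    intro j
    have := hpos j
    gcongr
  have D1 : ∀ t, 0 ≤ t → D t ≤ 1 := by
    intro t ht
    refine (Danti 0 t le_rfl ht).trans ?_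
    simp [hD, hsum]
  have lim : ∀ s, 0 < s → Tendsto (fun t => D (s * t) / D t) atTop (𝓝 (s ^ (α - 1))) := by
    intro s hs0
    have h1 := ((hc.comp (tendsto_id.const_mul_atTop hs0)).div hc hK.ne').mul
      ((hg s hs0).mul_const s⁻¹)
    rw [div_self hK.ne', one_mul, ← div_eq_mul_inv, ← Real.rpow_sub_one hs0.ne'] at h1
    refine h1.congr' ?_
    filter_upwards [eventually_gt_atTop 0] with t ht
    have e1 := (hgpos _ ht).ne'
    have e2 := (hgpos _ (mul_pos hs0 ht)).ne'
    have e3 := (Dpos t ht.le).ne'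
    simp only [Function.comp, id, hPD, Pi.div_apply]
    generalize g (s * t) = A at *
    generalize D (s * t) = B at *
    field_simp
  obtain ⟨β, hb0, hb1⟩ := exists_between hα0
  have hr : ∀ᶠ t in atTop, D (t / 2) ≤ 2 ^ (1 - β) * D t := by
    have h2 : ((1 / 2 : ℝ)) ^ (α - 1) < 2 ^ (1 - β) := by
      have : α - 1 = -(1 - α) := by ring
      rw [this, Real.rpow_neg (by norm_num), ← Real.inv_rpow (by norm_num)]
      norm_num
      exact hb1
    filter_upwards [(lim (1 / 2) (by norm_num)).eventually (gt_mem_nhds h2),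
      eventually_gt_atTop 0] with t h3 ht
    rw [div_lt_iff₀ (Dpos t ht.le)] at h3
    have h7 : t / 2 = 1 / 2 * t := by ring
    rw [h7]; exact h3.le
  obtain ⟨T, hT⟩ := eventually_atTop.1 (hr.and (eventually_gt_atTop 0))
  have hT0 : 0 < T := (hT T le_rfl).2
  have hDT := Dpos T hT0.le
  have E1 : ∀ x, 0 < x → D x ≤ (1 / D T) * D (max x T) := by
    intro x hx
    rcases le_total x T with h | h
    · rw [max_eq_right h, one_div_mul_cancel hDT.ne']; exact D1 x hx.le
    · rw [max_eq_left h]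
      have : 1 ≤ 1 / D T := by rw [le_div_iff₀ hDT, one_mul]; exact D1 T hT0.le
      have := Dpos x hx.le
      nlinarith
  have pot : ∀ t, T ≤ t → ∀ s, 0 < s → s ≤ 1 →
      D (s * t) ≤ (1 / D T) * (2 ^ (1 - β) * s ^ (-(1 - β)) * D t) := by
    intro t ht s hs0 hs1
    have ht0 := hT0.trans_le ht
    have h1 := s17_potter (fun x => D (max x T)) t (1 - β) (by linarith)
      (fun x hx => (Dpos _ (by positivity)).le)
      (fun x y hx hxy => Danti _ _ (by positivity) (by gcongr)) (by
        intro x hx _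
        have h2 : 1 ≤ (2 : ℝ) ^ (1 - β) := Real.one_le_rpow (by norm_num) (by linarith)
        rcases le_total x T with h | h
        · simp only [max_eq_right h, max_eq_right (show x / 2 ≤ T by linarith)]
          nlinarith
        · simp only [max_eq_left h]
          exact (Danti _ _ (by positivity) (le_max_left _ _)).trans (hT x h).1) s t hs0 hs1 ht0
          le_rfl
    simp only [max_eq_left ht] at h1
    calc _ ≤ _ := E1 _ (by positivity)
      _ ≤ _ := by gcongr
  have main : Tendsto (fun t => ∫ s in Set.Ioc (0 : ℝ) 1, D (s * t) / D t) atTop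
      (𝓝 (∫ s in Set.Ioc (0 : ℝ) 1, s ^ (α - 1))) := by
    apply tendsto_integral_filter_of_dominated_convergence
      (fun s => (1 / D T) * (2 ^ (1 - β) * s ^ (-(1 - β))))
    · filter_upwards [eventually_gt_atTop 0] with t ht
      apply AEMeasurable.aestronglyMeasurable
      apply AEMeasurable.div_const
      apply aemeasurable_restrict_of_antitoneOn measurableSet_Ioc
      intro x hx y hy hxy
      exact Danti _ _ (by have := hx.1; positivity) (by gcongr)
    · filter_upwards [eventually_ge_atTop T] with t htT
      have ht : 0 < t := hT0.trans_le htT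
      rw [ae_restrict_iff' measurableSet_Ioc]
      refine Eventually.of_forall fun s hs => ?_
      have hs1 := hs.1
      have d1 := Dpos t ht.le
      have d2 := Dpos (s * t) (by positivity)
      rw [Real.norm_eq_abs, abs_of_pos (by positivity), div_le_iff₀ d1]
      calc _ ≤ _ := pot t htT s hs.1 hs.2
        _ = _ := by ring
    · apply Integrable.const_mul
      apply Integrable.const_mul
      have := intervalIntegral.intervalIntegrable_rpow' (a := 0) (b := 1) (r := -(1 - β))
        (by linarith)
      rwa [intervalIntegrable_iff_integrableOn_Ioc_of_le zero_le_one] at this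
    · rw [ae_restrict_iff' measurableSet_Ioc]
      exact Eventually.of_forall fun s hs => lim s hs.1
  rw [← intervalIntegral.integral_of_le zero_le_one, integral_rpow (by left; linarith)] at main
  have m2 := hc.mul main
  have hv : α * Real.Gamma (1 - α) * ((1 ^ (α - 1 + 1) - 0 ^ (α - 1 + 1)) / (α - 1 + 1))
      = Real.Gamma (1 - α) := by
    rw [sub_add_cancel, Real.one_rpow, Real.zero_rpow hα0.ne']; field_simp; simp
  rw [hv] at m2
  refine m2.congr' ?_
  filter_upwards [eventually_gt_atTop 0] with t ht
  have d1 := (Dpos t ht.le).ne'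
  rw [integral_div, hPD, s17_rep2 hpos hs t ht]
  change t * D t / g t * ((∫ s in Set.Ioc (0 : ℝ) 1, D (s * t)) / D t)
    = t * (∫ s in Set.Ioc (0 : ℝ) 1, D (s * t)) / g t
  generalize (∫ s in Set.Ioc (0 : ℝ) 1, D (s * t)) = I
  generalize D t = d at *
  field_simp

open MeasureTheory in
lemma s17_wint (α : ℝ) (hα0 : 0 < α) (hα1 : α < 1) (c : ℝ) (hc : 0 ≤ c) :
    IntegrableOn (fun u : ℝ => (1 - Real.exp (-c * u)) * (α * u ^ (-α - 1))) (Set.Ioi 0) ∧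
    ∫ u in Set.Ioi (0 : ℝ), (1 - Real.exp (-c * u)) * (α * u ^ (-α - 1))
      = Real.Gamma (1 - α) * c ^ α := by
  rcases hc.eq_or_lt with rfl | hc0
  · simp [Real.zero_rpow hα0.ne']
  have hmeas : AEStronglyMeasurable (fun u : ℝ => (1 - Real.exp (-c * u)) * (α * u ^ (-α - 1)))
      (volume.restrict (Set.Ioi 0)) := by
    apply Measurable.aestronglyMeasurable; fun_prop
  have bd : ∀ u : ℝ, 0 < u → 0 ≤ 1 - Real.exp (-c * u) ∧ 1 - Real.exp (-c * u) ≤ 1 ∧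
      1 - Real.exp (-c * u) ≤ c * u := by
    intro u hu
    have h1 := Real.add_one_le_exp (-c * u)
    have h2 : Real.exp (-c * u) ≤ 1 := Real.exp_le_one_iff.2 (by nlinarith)
    have h3 := Real.exp_pos (-c * u)
    refine ⟨by linarith, by linarith, by linarith⟩
  have hI : IntegrableOn (fun u : ℝ => (1 - Real.exp (-c * u)) * (α * u ^ (-α - 1)))
      (Set.Ioi 0) := by
    rw [← Set.Ioc_union_Ioi_eq_Ioi zero_le_one, integrableOn_union]
    constructor
    · have h0 := intervalIntegral.intervalIntegrable_rpow' (a := 0) (b := 1) (r := -α)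
        (by linarith)
      rw [intervalIntegrable_iff_integrableOn_Ioc_of_le zero_le_one] at h0
      refine Integrable.mono' (h0.const_mul (c * α))
        (hmeas.mono_measure (Measure.restrict_mono Set.Ioc_subset_Ioi_self le_rfl)) ?_
      rw [ae_restrict_iff' measurableSet_Ioc]
      refine Eventually.of_forall fun u hu => ?_
      have hu0 := hu.1
      obtain ⟨b1, b2, b3⟩ := bd u hu0
      have hr : 0 < u ^ (-α - 1) := Real.rpow_pos_of_pos hu0 _
      have hr2 : u ^ (-α) = u ^ (-α - 1) * u := by
        rw [← Real.rpow_add_one hu0.ne']; congr 1; ring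
      rw [Real.norm_eq_abs, abs_of_nonneg (by positivity), hr2]
      calc _ ≤ c * u * (α * u ^ (-α - 1)) := by gcongr
        _ = _ := by ring
    · have h0 := integrableOn_Ioi_rpow_of_lt (a := -α - 1) (c := 1) (by linarith) one_pos
      refine Integrable.mono' (h0.const_mul α)
        (hmeas.mono_measure (Measure.restrict_mono (Set.Ioi_subset_Ioi zero_le_one) le_rfl)) ?_
      rw [ae_restrict_iff' measurableSet_Ioi]
      refine Eventually.of_forall fun u hu => ?_
      have hu0 : 0 < u := one_pos.trans hu
      obtain ⟨b1, b2, b3⟩ := bd u hu0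
      have hr : 0 < u ^ (-α - 1) := Real.rpow_pos_of_pos hu0 _
      rw [Real.norm_eq_abs, abs_of_nonneg (by positivity)]
      calc _ ≤ 1 * (α * u ^ (-α - 1)) := by gcongr
        _ = _ := by ring
  refine ⟨hI, ?_⟩
  have e0 : ∀ u : ℝ, c * (u ^ ((1 - α) - 1) * Real.exp (-(c * u)))
      = c * (u ^ (-α) * Real.exp (-c * u)) := by
    intro u; rw [show (1 - α) - 1 = -α by ring, neg_mul]
  have hJ : IntegrableOn (fun u : ℝ => c * (u ^ (-α) * Real.exp (-c * u))) (Set.Ioi 0) := by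
    have := integrableOn_rpow_mul_exp_neg_mul_rpow (p := 1) (s := -α) (b := c) (by linarith)
      one_pos hc0
    simp only [Real.rpow_one] at this
    exact this.const_mul c
  have hJv : ∫ u in Set.Ioi (0 : ℝ), c * (u ^ (-α) * Real.exp (-c * u))
      = Real.Gamma (1 - α) * c ^ α := by
    simp_rw [← e0]
    rw [integral_const_mul, Real.integral_rpow_mul_exp_neg_mul_Ioi (by linarith) hc0,
      one_div, Real.inv_rpow hc0.le, ← Real.rpow_neg hc0.le, ← mul_assoc]
    nth_rewrite 1 [← Real.rpow_one c]
    rw [← Real.rpow_add hc0, mul_comm]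
    congr 2; ring
  have lim0 : Tendsto (fun u : ℝ => (1 - Real.exp (-c * u)) * u ^ (-α)) (𝓝[>] 0) (𝓝 0) := by
    have h1 : Tendsto (fun u : ℝ => c * u ^ (1 - α)) (𝓝[>] 0) (𝓝 0) := by
      have : ContinuousAt (fun u : ℝ => c * u ^ (1 - α)) 0 :=
        (Real.continuousAt_rpow_const 0 (1 - α) (Or.inr (by linarith))).const_mul c
      have h2 := this.tendsto
      rw [Real.zero_rpow (by linarith), mul_zero] at h2
      exact h2.mono_left nhdsWithin_le_nhds
    refine squeeze_zero' ?_ ?_ h1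
    · filter_upwards [self_mem_nhdsWithin] with u hu
      have := (bd u hu).1
      have : 0 ≤ u ^ (-α) := Real.rpow_nonneg (le_of_lt hu) _
      positivity
    · filter_upwards [self_mem_nhdsWithin] with u hu
      simp only [Set.mem_Ioi] at hu
      have := (bd u hu).2.2
      have h3 : 0 ≤ u ^ (-α) := Real.rpow_nonneg hu.le _
      calc _ ≤ c * u * u ^ (-α) := by gcongr
        _ = c * (u ^ (-α) * u) := by ring
        _ = _ := by rw [← Real.rpow_add_one hu.ne']; congr 2; ring
  have limI : Tendsto (fun u : ℝ => (1 - Real.exp (-c * u)) * u ^ (-α)) atTop (𝓝 0) := by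
    refine squeeze_zero' ?_ ?_ (tendsto_rpow_neg_atTop hα0)
    · filter_upwards [eventually_gt_atTop 0] with u hu
      have := (bd u hu).1
      positivity
    · filter_upwards [eventually_gt_atTop 0] with u hu
      have := (bd u hu).2.1
      have h3 : 0 ≤ u ^ (-α) := Real.rpow_nonneg hu.le _
      nlinarith
  have hz := integral_Ioi_of_hasDerivAt_of_tendsto
    (f := fun u : ℝ => if u ≤ 0 then 0 else (1 - Real.exp (-c * u)) * u ^ (-α))
    (f' := fun u => c * (u ^ (-α) * Real.exp (-c * u))
      - (1 - Real.exp (-c * u)) * (α * u ^ (-α - 1))) (a := 0) (m := 0) (by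
      rw [← continuousWithinAt_Ioi_iff_Ici]
      unfold ContinuousWithinAt
      simp only [le_refl, if_true]
      refine lim0.congr' ?_
      filter_upwards [self_mem_nhdsWithin] with u hu
      rw [if_neg (not_le.2 hu)]) (by
      intro x hx
      simp only [Set.mem_Ioi] at hx
      have h1 : HasDerivAt (fun u : ℝ => (1 - Real.exp (-c * u)) * u ^ (-α))
          (c * (x ^ (-α) * Real.exp (-c * x))
            - (1 - Real.exp (-c * x)) * (α * x ^ (-α - 1))) x := by
        have := ((((hasDerivAt_id x).const_mul (-c)).exp).const_sub 1).mul
          (Real.hasDerivAt_rpow_const (x := x) (p := -α) (Or.inl hx.ne'))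
        refine this.congr_deriv ?_
        simp; ring
      refine h1.congr_of_eventuallyEq ?_
      filter_upwards [lt_mem_nhds hx] with u hu
      rw [if_neg (not_le.2 hu)]) (hJ.sub hI) (by
      refine limI.congr' ?_
      filter_upwards [eventually_gt_atTop 0] with u hu
      rw [if_neg (not_le.2 hu)])
  rw [integral_sub hJ hI, hJv] at hz
  simp at hz
  simp only [neg_mul]
  linarith

lemma s17_Tsum {p : ℕ → ℝ} (hpos : ∀ j, 0 < p j) (hs : Summable p) (h : ℝ → ℝ)
    (hc : Continuous h) (t : ℝ) (ht : 0 ≤ t) :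
    Summable (fun j => (1 - Real.exp (-t * p j)) * h (Real.exp (-t * p j))) := by
  obtain ⟨C, hC⟩ := isCompact_Icc.exists_bound_of_continuousOn (s := Set.Icc (0 : ℝ) 1)
    hc.continuousOn
  apply Summable.of_norm_bounded (g := fun j => t * p j * C) ((hs.mul_left t).mul_right C)
  intro j
  have hp := hpos j
  have h1 := Real.add_one_le_exp (-t * p j)
  have h2 : Real.exp (-t * p j) ≤ 1 := Real.exp_le_one_iff.2 (by nlinarith)
  have h3 := Real.exp_pos (-t * p j)
  have h4 := hC _ ⟨h3.le, h2⟩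
  rw [norm_mul, Real.norm_eq_abs, abs_of_nonneg (by linarith)]
  have h5 := norm_nonneg (h (Real.exp (-t * p j)))
  apply mul_le_mul _ h4 h5 (by positivity)
  linarith

open MeasureTheory in
lemma s17_Jint (α : ℝ) (hα0 : 0 < α) (hα1 : α < 1) (h : ℝ → ℝ)
    (hc : Continuous h) :
    IntegrableOn (fun u : ℝ => (1 - Real.exp (-u)) * (α * u ^ (-α - 1)) * h (Real.exp (-u)))
      (Set.Ioi 0) := by
  obtain ⟨C, hC⟩ := isCompact_Icc.exists_bound_of_continuousOn (s := Set.Icc (0 : ℝ) 1)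
    hc.continuousOn
  have hw := (s17_wint α hα0 hα1 1 zero_le_one).1
  simp only [neg_mul, one_mul] at hw
  refine Integrable.mul_bdd (c := C) hw (by
    apply Continuous.aestronglyMeasurable; fun_prop) ?_
  rw [ae_restrict_iff' measurableSet_Ioi]
  refine Eventually.of_forall fun u hu => hC _ ⟨(Real.exp_pos _).le, Real.exp_le_one_iff.2 ?_⟩
  simp only [Set.mem_Ioi] at hu
  linarith

open MeasureTheory in
lemma s17_kara {p : ℕ → ℝ} (hpos : ∀ j, 0 < p j) (hs : Summable p) (α : ℝ) (hα0 : 0 < α)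
    (hα1 : α < 1) (g : ℝ → ℝ) (hgpos : ∀ t, 0 < t → 0 < g t)
    (hg : ∀ c, 0 < c → Tendsto (fun t => g (c * t) / g t) atTop (𝓝 (c ^ α)))
    (hb : Tendsto (fun t => Phi p t / g t) atTop (𝓝 (Real.Gamma (1 - α))))
    (h : ℝ → ℝ) (hc : Continuous h) :
    Tendsto (fun t => (∑' j, (1 - Real.exp (-t * p j)) * h (Real.exp (-t * p j))) / g t) atTop
      (𝓝 (∫ u in Set.Ioi (0 : ℝ),
        (1 - Real.exp (-u)) * (α * u ^ (-α - 1)) * h (Real.exp (-u)))) := by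
  have hG : 0 < Real.Gamma (1 - α) := Real.Gamma_pos_of_pos (by linarith)
  set T : (ℝ → ℝ) → ℝ → ℝ :=
    fun h t => ∑' j, (1 - Real.exp (-t * p j)) * h (Real.exp (-t * p j)) with hT
  set J : (ℝ → ℝ) → ℝ := fun h => ∫ u in Set.Ioi (0 : ℝ),
        (1 - Real.exp (-u)) * (α * u ^ (-α - 1)) * h (Real.exp (-u)) with hJ
  change Tendsto (fun t => T h t / g t) atTop (𝓝 (J h))
  have hw := s17_wint α hα0 hα1
  -- scaling of Phi
  have hbs : ∀ c : ℝ, 0 ≤ c → Tendsto (fun t => Phi p (c * t) / g t) atTop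
      (𝓝 (Real.Gamma (1 - α) * c ^ α)) := by
    intro c hc
    rcases hc.eq_or_lt with rfl | hc
    · simp [Phi, Real.zero_rpow hα0.ne']
    have h1 := (hb.comp (tendsto_id.const_mul_atTop hc)).mul (hg c hc)
    refine h1.congr' ?_
    filter_upwards [eventually_gt_atTop 0] with t ht
    exact div_mul_div_cancel₀ (hgpos _ (by simpa using mul_pos hc ht)).ne'
  have hPs : ∀ t, 0 ≤ t → Summable (fun j => 1 - Real.exp (-t * p j)) := by
    intro t ht
    simpa using s17_Tsum hpos hs (fun _ => 1) continuous_const t ht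
  have poly : ∀ q : Polynomial ℝ, Tendsto (fun t => T (fun x => q.eval x) t / g t) atTop
      (𝓝 (J (fun x => q.eval x))) := by
    intro q
    induction q using Polynomial.induction_on' with
    | add q1 q2 h1 h2 =>
      have h3 := h1.add h2
      have e : J (fun x => (q1 + q2).eval x) = J (fun x => q1.eval x) + J (fun x => q2.eval x) := by
        simp only [hJ, Polynomial.eval_add, mul_add]
        exact integral_add (s17_Jint α hα0 hα1 _ q1.continuous)
          (s17_Jint α hα0 hα1 _ q2.continuous)
      rw [e]
      refine h3.congr' ?_
      filter_upwards [eventually_gt_atTop 0] with t ht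
      simp only [hT, Polynomial.eval_add, mul_add]
      rw [(s17_Tsum hpos hs _ q1.continuous t ht.le).tsum_add
        (s17_Tsum hpos hs _ q2.continuous t ht.le), add_div]
    | monomial n a =>
      have h3 := ((hbs (n + 1) (by positivity)).sub (hbs n (by positivity))).const_mul a
      have e : J (fun x => (Polynomial.monomial n a).eval x)
          = a * (Real.Gamma (1 - α) * (n + 1 : ℝ) ^ α - Real.Gamma (1 - α) * (n : ℝ) ^ α) := by
        rw [← (hw (n + 1) (by positivity)).2, ← (hw n (by positivity)).2,
          ← integral_sub (hw (n + 1) (by positivity)).1 (hw n (by positivity)).1,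
          ← integral_const_mul]
        simp only [hJ, Polynomial.eval_monomial]
        congr 1
        ext u
        rw [← Real.exp_nat_mul, show -((n : ℝ) + 1) * u = n * -u + -u by ring, Real.exp_add,
          show -(n : ℝ) * u = n * -u by ring]
        ring
      rw [e]
      refine h3.congr' ?_
      filter_upwards [eventually_gt_atTop 0] with t ht
      rw [← sub_div, ← mul_div_assoc]
      congr 1
      simp only [hT, Phi, Polynomial.eval_monomial]
      rw [← (hPs _ (by positivity)).tsum_sub (hPs _ (by positivity)), ← tsum_mul_left]
      apply tsum_congr
      intro j
      rw [← Real.exp_nat_mul, show -(((n : ℝ) + 1) * t) * p j = n * (-t * p j) + -t * p j by ring,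
        Real.exp_add, show -((n : ℝ) * t) * p j = n * (-t * p j) by ring]
      ring
  have J1 := (hw 1 zero_le_one).2
  have I1 := (hw 1 zero_le_one).1
  simp only [neg_mul, one_mul, Real.one_rpow, mul_one] at J1 I1
  rw [Metric.tendsto_atTop']
  intro ε hε
  set M := 2 * Real.Gamma (1 - α) + 2 with hM
  obtain ⟨q, hq⟩ := exists_polynomial_near_of_continuousOn 0 1 h hc.continuousOn
    (ε / (2 * M)) (by positivity)
  set η := ε / (2 * M) with hη
  have hη0 : 0 < η := by positivity
  have Jd : |J (fun x => q.eval x) - J h| ≤ η * Real.Gamma (1 - α) := by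
    simp only [hJ]
    rw [← integral_sub (s17_Jint α hα0 hα1 _ q.continuous) (s17_Jint α hα0 hα1 _ hc), ← J1,
      ← integral_const_mul, ← Real.norm_eq_abs]
    apply norm_integral_le_of_norm_le (I1.const_mul η)
    rw [ae_restrict_iff' measurableSet_Ioi]
    refine Eventually.of_forall fun u hu => ?_
    simp only [Set.mem_Ioi] at hu
    have e1 : Real.exp (-u) ≤ 1 := Real.exp_le_one_iff.2 (by linarith)
    have hw0 : 0 ≤ (1 - Real.exp (-u)) * (α * u ^ (-α - 1)) :=
      mul_nonneg (by linarith) (by positivity)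
    rw [← mul_sub, norm_mul, Real.norm_eq_abs, abs_of_nonneg hw0, mul_comm]
    exact mul_le_mul_of_nonneg_right (hq _ ⟨(Real.exp_pos _).le, e1⟩).le hw0
  have Td : ∀ t, 0 < t → |T (fun x => q.eval x) t - T h t| ≤ η * Phi p t := by
    intro t ht
    simp only [hT, Phi]
    rw [← (s17_Tsum hpos hs _ q.continuous t ht.le).tsum_sub (s17_Tsum hpos hs _ hc t ht.le),
      ← tsum_mul_left, ← Real.norm_eq_abs]
    apply tsum_of_norm_bounded ((hPs t ht.le).mul_left η).hasSum
    intro j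
    have hp := hpos j
    have e1 : Real.exp (-t * p j) ≤ 1 := Real.exp_le_one_iff.2 (by nlinarith)
    rw [← mul_sub, norm_mul, Real.norm_eq_abs, abs_of_nonneg (sub_nonneg.2 e1), mul_comm]
    exact mul_le_mul_of_nonneg_right (hq _ ⟨(Real.exp_pos _).le, e1⟩).le (sub_nonneg.2 e1)
  have ev1 := (poly q).eventually (Metric.ball_mem_nhds _ hη0)
  have ev2 := hb.eventually (gt_mem_nhds (lt_add_one (Real.Gamma (1 - α))))
  obtain ⟨N, hN⟩ := eventually_atTop.1 (ev1.and (ev2.and (eventually_gt_atTop 0)))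
  refine ⟨N, fun t ht => ?_⟩
  obtain ⟨k1, k2, k3⟩ := hN t ht.le
  have gt := hgpos t k3
  rw [Real.dist_eq] at k1
  rw [Real.dist_eq]
  have k4 : |T (fun x => q.eval x) t / g t - T h t / g t| ≤ η * (Real.Gamma (1 - α) + 1) := by
    rw [← sub_div, abs_div, abs_of_pos gt]
    calc _ ≤ η * Phi p t / g t := by gcongr; exact Td t k3
      _ = η * (Phi p t / g t) := by ring
      _ ≤ _ := by gcongr
  have hM0 : M ≠ 0 := by rw [hM]; positivity
  have k5 : η * M = ε / 2 := by rw [hη]; field_simp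
  have k6 : |T h t / g t - J h| < η * M + ε / 4 := by
    rw [abs_le] at k4 Jd
    rw [abs_lt] at k1 ⊢
    rw [hM]
    constructor <;> nlinarith
  linarith

open MeasureTheory in
lemma s17_ba {p : ℕ → ℝ} (hpos : ∀ j, 0 < p j) (hs : Summable p) (α : ℝ) (hα0 : 0 < α)
    (hα1 : α < 1) (g : ℝ → ℝ) (hgpos : ∀ t, 0 < t → 0 < g t)
    (hg : ∀ c, 0 < c → Tendsto (fun t => g (c * t) / g t) atTop (𝓝 (c ^ α)))
    (hb : Tendsto (fun t => Phi p t / g t) atTop (𝓝 (Real.Gamma (1 - α)))) :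
    Tendsto (fun t => nubar p (1 / t) / g t) atTop (𝓝 1) := by
  have key : ∀ c : ℝ, 1 < c → ∃ (S : ℝ → ℝ) (I : ℝ), Tendsto (fun t => S t / g t) atTop (𝓝 I) ∧
      c ^ (-α) ≤ I ∧ I ≤ 1 ∧ (∀ t, 0 < t → S t ≤ nubar p (1 / t)) ∧
      (∀ t, 0 < t → nubar p (1 / t) ≤ S (c * t)) := by
    intro c hc
    have hc0 : 0 < c := one_pos.trans hc
    set e1 := Real.exp (-1) with he1
    set ec := Real.exp (-c) with hec
    have hlt : ec < e1 := Real.exp_lt_exp.2 (by linarith)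
    have he11 : e1 < 1 := by rw [he1, Real.exp_lt_one_iff]; norm_num
    set G : ℝ → ℝ := fun x => max 0 (min 1 ((e1 - x) / (e1 - ec))) with hG
    have G0 : ∀ x, 0 ≤ G x := fun x => le_max_left _ _
    have G1 : ∀ x, G x ≤ 1 := fun x => max_le zero_le_one (min_le_left _ _)
    have Gz : ∀ x, e1 ≤ x → G x = 0 := by
      intro x hx
      apply max_eq_left
      refine (min_le_right _ _).trans (div_nonpos_of_nonpos_of_nonneg (by linarith) (by linarith))
    have Go : ∀ x, x ≤ ec → G x = 1 := by
      intro x hx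
      have : 1 ≤ (e1 - x) / (e1 - ec) := by
        rw [le_div_iff₀ (by linarith)]; linarith
      simp only [hG, min_eq_left this, max_eq_right zero_le_one]
    set h : ℝ → ℝ := fun x => G x / max (1 - x) (1 - e1) with hh
    have hcont : Continuous h := by
      have : ∀ x : ℝ, max (1 - x) (1 - e1) ≠ 0 := fun x =>
        (lt_of_lt_of_le (by linarith) (le_max_right (1 - x) (1 - e1))).ne'
      apply Continuous.div _ (by fun_prop) this
      simp only [hG]
      fun_prop
    have hid : ∀ x, (1 - x) * h x = G x := by
      intro x
      rcases le_or_gt e1 x with hx | hx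
      · simp [hh, Gz x hx]
      · simp only [hh]
        rw [max_eq_left (by linarith)]
        have : 1 - x ≠ 0 := by linarith
        field_simp
    have hGz : ∀ u, u ≤ 1 → G (Real.exp (-u)) = 0 := fun u hu =>
      Gz _ (Real.exp_le_exp.2 (by linarith))
    have hGo : ∀ u, c ≤ u → G (Real.exp (-u)) = 1 := fun u hu =>
      Go _ (Real.exp_le_exp.2 (by linarith))
    have kk := s17_kara hpos hs α hα0 hα1 g hgpos hg hb h hcont
    have hJi := s17_Jint α hα0 hα1 h hcont
    have eI : ∀ u : ℝ, (1 - Real.exp (-u)) * (α * u ^ (-α - 1)) * h (Real.exp (-u))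
        = G (Real.exp (-u)) * (α * u ^ (-α - 1)) := by
      intro u; rw [← hid]; ring
    have hGs : ∀ t, 0 ≤ t → Summable (fun j => G (Real.exp (-t * p j))) := by
      intro t ht
      have := s17_Tsum hpos hs h hcont t ht
      simpa only [hid] using this
    simp only [eI] at kk hJi
    simp only [hid] at kk
    have ip : ∀ a : ℝ, 0 < a → IntegrableOn (fun u : ℝ => α * u ^ (-α - 1)) (Set.Ioi a) ∧
        ∫ u in Set.Ioi a, α * u ^ (-α - 1) = a ^ (-α) := by
      intro a ha
      refine ⟨(integrableOn_Ioi_rpow_of_lt (by linarith) ha).const_mul α, ?_⟩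
      rw [integral_const_mul, integral_Ioi_rpow_of_lt (by linarith) ha]
      have : -α - 1 + 1 = -α := by ring
      rw [this]; field_simp
    refine ⟨_, _, kk, ?_, ?_, ?_, ?_⟩
    · rw [← (ip c hc0).2]
      rw [← setIntegral_congr_fun (f := fun u : ℝ => G (Real.exp (-u)) * (α * u ^ (-α - 1)))
        measurableSet_Ioi (fun u hu => by
          simp only [Set.mem_Ioi] at hu
          simp [hGo u hu.le])]
      apply setIntegral_mono_set hJi _ (Set.Ioi_subset_Ioi hc0.le).eventuallyLE
      rw [EventuallyLE, ae_restrict_iff' measurableSet_Ioi]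
      refine Eventually.of_forall fun u hu => ?_
      simp only [Set.mem_Ioi] at hu
      have := G0 (Real.exp (-u))
      simp only [Pi.zero_apply]
      positivity
    · have h1 := (ip 1 one_pos)
      rw [Real.one_rpow] at h1
      refine le_of_le_of_eq ?_ h1.2
      rw [setIntegral_eq_of_subset_of_forall_sdiff_eq_zero (s := Set.Ioi 1) measurableSet_Ioi
        (Set.Ioi_subset_Ioi zero_le_one) (by
          intro u hu
          have : u ≤ 1 := by simpa using hu.2
          rw [hGz u this, zero_mul])]
      apply setIntegral_mono_on (hJi.mono_set (Set.Ioi_subset_Ioi zero_le_one)) h1.1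
        measurableSet_Ioi
      intro u hu
      have hu0 : 0 < u := one_pos.trans hu
      have h2 : 0 ≤ α * u ^ (-α - 1) := by positivity
      exact mul_le_of_le_one_left h2 (G1 _)
    · intro t ht
      have hn := s17_nubar_hasSum hs (one_div_pos.2 ht)
      rw [← hn.tsum_eq]
      apply (hGs t ht.le).tsum_le_tsum _ hn.summable
      intro j
      split_ifs with hj
      · exact G1 _
      · rw [div_le_iff₀' ht] at hj
        rw [neg_mul, hGz _ (not_le.1 hj).le]
    · intro t ht
      have hn := s17_nubar_hasSum hs (one_div_pos.2 ht)
      rw [← hn.tsum_eq]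
      apply hn.summable.tsum_le_tsum _ (hGs (c * t) (by positivity))
      intro j
      split_ifs with hj
      · rw [div_le_iff₀' ht] at hj
        rw [neg_mul, hGo _ (by rw [mul_assoc]; nlinarith)]
      · exact G0 _
  rw [tendsto_order]
  constructor
  · intro a ha
    have hc : ∀ᶠ c : ℝ in 𝓝[>] 1, a < c ^ (-α) := by
      have : ContinuousAt (fun c : ℝ => c ^ (-α)) 1 :=
        Real.continuousAt_rpow_const 1 (-α) (Or.inl one_ne_zero)
      have h2 := this.tendsto
      rw [Real.one_rpow] at h2
      exact (h2.mono_left nhdsWithin_le_nhds).eventually (lt_mem_nhds ha)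
    obtain ⟨c, hca, hc1⟩ := (hc.and self_mem_nhdsWithin).exists
    obtain ⟨S, I, h1, h2, h3, h4, h5⟩ := key c hc1
    filter_upwards [h1.eventually (lt_mem_nhds (hca.trans_le h2)), eventually_gt_atTop 0]
      with t k1 k2
    have := hgpos t k2
    exact k1.trans_le (by gcongr; exact h4 t k2)
  · intro b hb1
    have hc : ∀ᶠ c : ℝ in 𝓝[>] 1, c ^ α < b := by
      have : ContinuousAt (fun c : ℝ => c ^ α) 1 :=
        Real.continuousAt_rpow_const 1 α (Or.inl one_ne_zero)
      have h2 := this.tendsto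
      rw [Real.one_rpow] at h2
      exact (h2.mono_left nhdsWithin_le_nhds).eventually (gt_mem_nhds hb1)
    obtain ⟨c, hca, hc1⟩ := (hc.and self_mem_nhdsWithin).exists
    obtain ⟨S, I, h1, h2, h3, h4, h5⟩ := key c hc1
    have hc0 : 0 < c := one_pos.trans hc1
    have hcp : 0 < c ^ α := Real.rpow_pos_of_pos hc0 _
    have h6 := (h1.comp (tendsto_id.const_mul_atTop hc0)).mul (hg c hc0)
    have h7 : I * c ^ α < b := lt_of_le_of_lt (by nlinarith) hca
    filter_upwards [h6.eventually (gt_mem_nhds h7), eventually_gt_atTop 0] with t k1 k2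
    have := hgpos t k2
    simp only [Function.comp, id] at k1
    rw [div_mul_div_cancel₀ (hgpos _ (mul_pos hc0 k2)).ne'] at k1
    refine lt_of_le_of_lt ?_ k1
    gcongr
    exact h5 t k2

/-- For `0 < α < 1` the following are equivalent:
(a) `ν̄(x) ∼ ℓ(1/x) x^{-α}` (x → 0+);
(b) `Φ(t) ∼ Γ(1−α) t^α ℓ(t)` (t → ∞);
(c) `Φ_1(t) ∼ α Γ(1−α) t^α ℓ(t)` (t → ∞);
and each implies `Φ_r(t) ∼ (α Γ(r−α)/r!) t^α ℓ(t)` for every `r ≥ 1`. -/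
theorem stmt_17 (p : ℕ → ℝ) (hpos : ∀ j, 0 < p j) (hmono : Antitone p)
    (hsum : ∑' j, p j = 1)
    (α : ℝ) (hα0 : 0 < α) (hα1 : α < 1)
    (ℓ : ℝ → ℝ) (hℓpos : ∀ y : ℝ, 0 < y → 0 < ℓ y) (hℓ : SlowlyVarying ℓ) :
    (Tendsto (fun x : ℝ => nubar p x / (ℓ (1 / x) * x ^ (-α))) (𝓝[>] 0) (𝓝 1) ↔
      Tendsto (fun t : ℝ => Phi p t / (Real.Gamma (1 - α) * t ^ α * ℓ t))
        atTop (𝓝 1)) ∧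
    (Tendsto (fun t : ℝ => Phi p t / (Real.Gamma (1 - α) * t ^ α * ℓ t))
        atTop (𝓝 1) ↔
      Tendsto (fun t : ℝ => PhiR p 1 t / (α * Real.Gamma (1 - α) * t ^ α * ℓ t))
        atTop (𝓝 1)) ∧
    (Tendsto (fun x : ℝ => nubar p x / (ℓ (1 / x) * x ^ (-α))) (𝓝[>] 0) (𝓝 1) →
      ∀ r : ℕ, 1 ≤ r →
        Tendsto
          (fun t : ℝ =>
            PhiR p r t /
              (α * Real.Gamma ((r : ℝ) - α) / (Nat.factorial r) * t ^ α * ℓ t))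
          atTop (𝓝 1)) := by
  have hs := s17_summable hsum
  have hΓ : 0 < Real.Gamma (1 - α) := Real.Gamma_pos_of_pos (by linarith)
  obtain ⟨g, hgd⟩ : ∃ g : ℝ → ℝ, g = fun t => t ^ α * ℓ t := ⟨_, rfl⟩
  have hgpos : ∀ t, 0 < t → 0 < g t := by
    intro t ht
    have := hℓpos t ht
    rw [hgd]; positivity
  have hg : ∀ c, 0 < c → Tendsto (fun t => g (c * t) / g t) atTop (𝓝 (c ^ α)) := by
    intro c hc
    have h1 := (hℓ c hc).const_mul (c ^ α)
    rw [mul_one] at h1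
    refine h1.congr' ?_
    filter_upwards [eventually_gt_atTop 0] with t ht
    have h2 : t ^ α ≠ 0 := (Real.rpow_pos_of_pos ht α).ne'
    have h3 := (hℓpos t ht).ne'
    simp only [hgd]
    rw [Real.mul_rpow hc.le ht.le]
    generalize ℓ (c * t) = A
    field_simp
  have gen : ∀ (F : ℝ → ℝ) (K : ℝ), 0 < K → (Tendsto (fun t => F t / (K * t ^ α * ℓ t)) atTop (𝓝 1)
      ↔ Tendsto (fun t => F t / g t) atTop (𝓝 K)) := by
    intro F K hK
    constructor
    · intro h
      have h1 := h.const_mul K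
      rw [mul_one] at h1
      refine h1.congr fun t => ?_
      simp only [hgd]
      rw [mul_assoc K, ← mul_div_assoc, mul_div_mul_left _ _ hK.ne']
    · intro h
      have h1 := h.div_const K
      rw [div_self hK.ne'] at h1
      refine h1.congr fun t => ?_
      simp only [hgd]
      rw [div_div]
      congr 1
      ring
  have hA : Tendsto (fun x : ℝ => nubar p x / (ℓ (1 / x) * x ^ (-α))) (𝓝[>] 0) (𝓝 1) ↔
      Tendsto (fun t => nubar p (1 / t) / g t) atTop (𝓝 1) := by
    have e : ∀ x : ℝ, 0 < x → nubar p x / (ℓ (1 / x) * x ^ (-α))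
        = nubar p (1 / (1 / x)) / g (1 / x) := by
      intro x hx
      rw [one_div_one_div, hgd]
      simp only
      rw [one_div, Real.inv_rpow hx.le, Real.rpow_neg hx.le, mul_comm]
    constructor
    · intro h
      have h1 := h.comp tendsto_inv_atTop_nhdsGT_zero
      refine h1.congr' ?_
      filter_upwards [eventually_gt_atTop 0] with t ht
      have := e t⁻¹ (inv_pos.2 ht)
      simp only [Function.comp]
      rw [this]
      simp
    · intro h
      have h1 := h.comp tendsto_inv_nhdsGT_zero
      refine h1.congr' ?_
      filter_upwards [self_mem_nhdsWithin] with x hx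
      rw [e x hx]
      simp
  have ab := s17_ab hpos hs α hα0 hα1 g hgpos hg
  have ba := s17_ba hpos hs α hα0 hα1 g hgpos hg
  have cb := s17_cb hpos hsum α hα0 hα1 g hgpos hg
  have ar := s17_ar hpos hs α hα0 hα1 g hgpos hg
  refine ⟨?_, ?_, ?_⟩
  · rw [hA, gen _ _ hΓ]
    exact ⟨ab, ba⟩
  · rw [gen _ _ hΓ, gen _ _ (mul_pos hα0 hΓ)]
    refine ⟨fun h => ?_, cb⟩
    have := ar (ba h) 0
    simpa using this
  · rw [hA]
    intro h r hr
    obtain ⟨m, rfl⟩ : ∃ m, r = m + 1 := ⟨r - 1, by omega⟩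
    have hG : 0 < Real.Gamma (((m + 1 : ℕ) : ℝ) - α) := by
      apply Real.Gamma_pos_of_pos
      have : (0 : ℝ) ≤ m := Nat.cast_nonneg m
      push_cast
      linarith
    rw [gen _ _ (by positivity)]
    exact ar h m
end

section
/- Let ℓ be slowly varying at ∞ and suppose ν̄(x) ~ x^{−1} ℓ(1/x) as x → 0+, and let ℓ_1(y) = ∫_y^∞ u^{−1} ℓ(u) du (which converges for large y and is slowly varying). Then Φ(t) ~ Φ_1(t) ~ t ℓ_1(t) as t → ∞, and for every integer r > 1, Φ_r(t) ~ (1/(r(r−1))) t ℓ(t) as t → ∞. Moreover, for any slowly varying ℓ_1, the conditions ν_1[0,x] ~ ℓ_1(1/x) (x → 0+) and Φ_1(t) ~ t ℓ_1(t) (t → ∞) are equivalent. -/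
open Filter Topology MeasureTheory

/-- `ν_1[0,x] = ∑_j p_j · 1(p_j ≤ x)`. -/
noncomputable def nuOne (p : ℕ → ℝ) (x : ℝ) : ℝ := ∑' j, if p j ≤ x then p j else 0

/-- `ℓ_1(y) = ∫_y^∞ u^{-1} ℓ(u) du`. -/
noncomputable def ellOne (ℓ : ℝ → ℝ) (y : ℝ) : ℝ := ∫ u in Set.Ioi y, ℓ u / u


section aux
variable {p : ℕ → ℝ}

lemma aux_summable (hsum : ∑' j, p j = 1) : Summable p := by
  by_contra h
  rw [tsum_eq_zero_of_not_summable h] at hsum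
  norm_num at hsum

lemma aux_fin (hs : Summable p) {x : ℝ} (hx : 0 < x) : {j | x ≤ p j}.Finite := by
  have h := hs.tendsto_cofinite_zero
  have h2 := h.eventually (gt_mem_nhds hx)
  rw [Filter.eventually_cofinite] at h2
  refine h2.subset ?_
  intro j hj
  simpa using hj

lemma aux_nubar (hs : Summable p) {x : ℝ} (hx : 0 < x) :
    HasSum (fun j => if x ≤ p j then (1:ℝ) else 0) (nubar p x) := by
  have hf := aux_fin hs hx
  have h : HasSum (fun j => if x ≤ p j then (1:ℝ) else 0)
      (∑ j ∈ hf.toFinset, if x ≤ p j then (1:ℝ) else 0) := by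
    apply hasSum_sum_of_ne_finset_zero
    intro b hb
    simp at hb
    simp [hb]
  convert h using 1
  unfold nubar
  rw [Set.ncard_eq_toFinset_card _ hf, Finset.sum_congr rfl (g := fun _ => (1:ℝ))]
  · simp
  · intro j hj
    have : x ≤ p j := by simpa using hj
    simp [this]

lemma aux_nubar_anti (hs : Summable p) {x y : ℝ} (hx : 0 < x) (hxy : x ≤ y) :
    nubar p y ≤ nubar p x := by
  refine hasSum_le ?_ (aux_nubar hs (hx.trans_le hxy)) (aux_nubar hs hx)
  intro j
  by_cases h1 : y ≤ p j
  · simp [h1, hxy.trans h1]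
  · simp only [h1, if_false]
    split_ifs <;> norm_num

lemma aux_nubar_pos (hs : Summable p) {x : ℝ} (hx : 0 < x) (hx0 : x ≤ p 0) :
    0 < nubar p x := by
  unfold nubar
  have := (Set.ncard_pos (aux_fin hs hx)).2 ⟨0, hx0⟩
  exact_mod_cast this

/-- counting function in the variable 1/x -/
noncomputable def auxM (p : ℕ → ℝ) (y : ℝ) : ℝ := nubar p (1 / y)

lemma auxM_nonneg (y : ℝ) : 0 ≤ auxM p y := by unfold auxM nubar; positivity

lemma auxM_mono (hs : Summable p) {x y : ℝ} (hx : 0 < x) (hxy : x ≤ y) :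
    auxM p x ≤ auxM p y :=
  aux_nubar_anti hs (by have := hx.trans_le hxy; positivity) (one_div_le_one_div_of_le hx hxy)

lemma auxM_pos (hs : Summable p) (h0 : 0 < p 0) : ∀ᶠ y in atTop, 0 < auxM p y := by
  filter_upwards [eventually_ge_atTop (1 / p 0), eventually_gt_atTop 0] with y hy hy0
  refine aux_nubar_pos hs (by positivity) ?_
  rw [div_le_iff₀ h0] at hy
  rw [div_le_iff₀ hy0]; linarith

lemma auxM_meas (hs : Summable p) : AEMeasurable (auxM p) (volume.restrict (Set.Ioi (0:ℝ))) := by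
  apply aemeasurable_restrict_of_monotoneOn measurableSet_Ioi
  intro x hx y hy hxy
  exact auxM_mono hs hx hxy

lemma aux_layer (hs : Summable p) (hpos : ∀ j, 0 < p j) (g f : ℝ → ℝ) (hg : Continuous g)
    (C : ℝ) (hgC : ∀ u, 0 < u → |g u| ≤ C)
    (hf : ∀ x, 0 < x → ∫ u in Set.Ioc 0 x, g u = f x) {t : ℝ} (ht : 0 < t) :
    ∑' j, f (t * p j) = ∫ u in Set.Ioi (0:ℝ), g u * auxM p (t / u) := by
  have hI : ∀ j, IntegrableOn g (Set.Ioc 0 (t * p j)) := fun j =>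
    (hg.integrableOn_Icc).mono_set Set.Ioc_subset_Icc_self
  have key := integral_tsum_of_summable_integral_norm (μ := volume.restrict (Set.Ioi (0:ℝ)))
    (F := fun j => (Set.Ioc 0 (t * p j)).indicator g) ?_ ?_
  · have e1 : ∀ j, ∫ u in Set.Ioi (0:ℝ), (Set.Ioc 0 (t * p j)).indicator g u = f (t * p j) := by
      intro j
      rw [setIntegral_indicator measurableSet_Ioc, ← hf _ (mul_pos ht (hpos j))]
      congr 2
      ext u; simp
    simp_rw [e1] at key
    rw [key]
    apply setIntegral_congr_fun measurableSet_Ioi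
    intro u hu
    have hu : 0 < u := hu
    have := (aux_nubar hs (x := 1 / (t / u)) (by positivity)).mul_left (g u)
    simp only [auxM]
    rw [← this.tsum_eq]
    congr 1
    ext j
    have : 1 / (t / u) ≤ p j ↔ u ≤ t * p j := by
      rw [one_div_div, div_le_iff₀ ht, mul_comm]
    simp only [Set.indicator, Set.mem_Ioc, hu, this, true_and, mul_ite, mul_one, mul_zero]
  · intro j
    exact ((hI j).integrable_indicator measurableSet_Ioc).integrableOn
  · refine Summable.of_nonneg_of_le (fun j => by positivity) (fun j => ?_)
      ((hs.mul_left t).mul_left C)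
    have htp := mul_pos ht (hpos j)
    calc ∫ u in Set.Ioi (0:ℝ), ‖(Set.Ioc 0 (t * p j)).indicator g u‖
        = ∫ u in Set.Ioc 0 (t * p j), ‖g u‖ := by
          simp_rw [norm_indicator_eq_indicator_norm]
          rw [setIntegral_indicator measurableSet_Ioc]
          congr 2
          ext u; simp
      _ ≤ ∫ u in Set.Ioc 0 (t * p j), C := by
          apply setIntegral_mono_on (hI j).norm (by simp) measurableSet_Ioc
          intro u hu
          exact hgC u hu.1
      _ = C * (t * p j) := by
          simp [htp.le, mul_comm]

lemma aux_potter (hs : Summable p) (h0 : 0 < p 0)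
    (hM : ∀ c : ℝ, 0 < c → Tendsto (fun y => auxM p (c * y) / auxM p y) atTop (𝓝 c)) :
    ∀ᶠ t in atTop, ∀ u : ℝ, 0 < u → auxM p (t / u) ≤ (1 + 8 * u ^ (-(3/2) : ℝ)) * auxM p t := by
  have h4 : ∀ᶠ y in atTop, auxM p (4 * y) ≤ 8 * auxM p y := by
    filter_upwards [(hM 4 (by norm_num)).eventually (gt_mem_nhds (show (4:ℝ) < 8 by norm_num)),
      auxM_pos hs h0] with y hy hp
    rw [div_lt_iff₀ hp] at hy
    exact hy.le
  obtain ⟨T, hT⟩ := eventually_atTop.1 h4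
  filter_upwards [eventually_ge_atTop T, eventually_gt_atTop 0] with t htT ht u hu
  have hMt := auxM_nonneg (p := p) t
  rcases le_total 1 u with h1 | h1
  · have : auxM p (t / u) ≤ auxM p t := auxM_mono hs (by positivity) (div_le_self ht.le h1)
    have h2 : 0 ≤ 8 * u ^ (-(3/2) : ℝ) := by positivity
    nlinarith
  · have hk : ∀ k : ℕ, auxM p (4 ^ k * t) ≤ 8 ^ k * auxM p t := by
      intro k
      induction k with
      | zero => simp
      | succ k ih =>
        have h3 : T ≤ 4 ^ k * t := by
          have : (1:ℝ) ≤ 4 ^ k := one_le_pow₀ (by norm_num)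
          nlinarith
        have := hT _ h3
        rw [pow_succ, pow_succ, mul_comm _ (4:ℝ), mul_assoc]
        nlinarith
    have hv : 1 ≤ u⁻¹ := (one_le_inv₀ hu).2 h1
    obtain ⟨k, hk1, hk2⟩ := exists_nat_pow_near hv (show (1:ℝ) < 4 by norm_num)
    have h5 : auxM p (t / u) ≤ auxM p (4 ^ (k+1) * t) := by
      apply auxM_mono hs (by positivity)
      rw [div_eq_mul_inv]; nlinarith
    have h6 : (8:ℝ) ^ k ≤ u ^ (-(3/2) : ℝ) := by
      have : (8:ℝ) ^ k = ((4:ℝ) ^ k) ^ (3/2 : ℝ) := by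
        rw [← Real.rpow_natCast, ← Real.rpow_natCast, ← Real.rpow_mul (by norm_num), mul_comm,
          Real.rpow_mul (by norm_num)]
        congr 1
        rw [show (4:ℝ) = 2 ^ (2:ℝ) by norm_num, ← Real.rpow_mul (by norm_num)]
        norm_num
      rw [this, Real.rpow_neg hu.le, ← Real.inv_rpow hu.le]
      exact Real.rpow_le_rpow (by positivity) hk1 (by norm_num)
    have := hk (k+1)
    rw [pow_succ (8:ℝ)] at this
    nlinarith [mul_le_mul_of_nonneg_right h6 hMt]

lemma aux_A (hs : Summable p) (hpos : ∀ j, 0 < p j)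
    (hM : ∀ c : ℝ, 0 < c → Tendsto (fun y => auxM p (c * y) / auxM p y) atTop (𝓝 c))
    (g f : ℝ → ℝ) (hg : Continuous g)
    (C : ℝ) (hgC : ∀ u, 0 < u → |g u| ≤ C * (u * Real.exp (-(u / 2))))
    (hf : ∀ x, 0 < x → ∫ u in Set.Ioc 0 x, g u = f x) :
    Tendsto (fun t => (∑' j, f (t * p j)) / auxM p t) atTop (𝓝 (∫ u in Set.Ioi (0:ℝ), g u / u)) := by
  have hC : 0 ≤ C := by
    have := (abs_nonneg _).trans (hgC 1 one_pos)
    by_contra h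
    push Not at h
    have h2 : 0 < 1 * Real.exp (-((1:ℝ)/2)) := by positivity
    nlinarith
  have hgC' : ∀ u, 0 < u → |g u| ≤ 2 * C := by
    intro u hu
    refine (hgC u hu).trans ?_
    have h1 : u / 2 * Real.exp (-(u/2)) ≤ 1 := by
      rw [Real.exp_neg, ← div_eq_mul_inv, div_le_one (Real.exp_pos _)]
      linarith [Real.add_one_le_exp (u/2)]
    nlinarith
  have e : ∀ᶠ t in atTop, ∫ u in Set.Ioi (0:ℝ), g u * (auxM p (t / u) / auxM p t) =
      (∑' j, f (t * p j)) / auxM p t := by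
    filter_upwards [eventually_gt_atTop 0] with t ht
    rw [aux_layer hs hpos g f hg _ hgC' hf ht, ← integral_div]
    congr 1; ext u; ring
  refine Tendsto.congr' e ?_
  apply tendsto_integral_filter_of_dominated_convergence
    (fun u => C * (u ^ ((2:ℝ)-1) * Real.exp (-(1/2 * u))) +
      8 * C * (u ^ ((1/2:ℝ)-1) * Real.exp (-(1/2 * u))))
  · filter_upwards [eventually_gt_atTop 0] with t ht
    apply AEStronglyMeasurable.mul hg.aestronglyMeasurable
    apply AEMeasurable.aestronglyMeasurable
    apply AEMeasurable.div_const
    apply aemeasurable_restrict_of_antitoneOn measurableSet_Ioi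
    intro x hx y hy hxy
    have hx : 0 < x := hx
    have hy : 0 < y := hy
    exact auxM_mono hs (by positivity) (by gcongr)
  · filter_upwards [aux_potter hs (hpos 0) hM, auxM_pos hs (hpos 0)] with t ht hp
    rw [ae_restrict_iff' measurableSet_Ioi]
    refine Eventually.of_forall fun u hu => ?_
    have hu : 0 < u := hu
    have h1 : auxM p (t / u) / auxM p t ≤ 1 + 8 * u ^ (-(3/2) : ℝ) := by
      rw [div_le_iff₀ hp]; exact ht u hu
    have h2 : 0 ≤ auxM p (t / u) / auxM p t := div_nonneg (auxM_nonneg _) hp.le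
    rw [norm_mul, Real.norm_eq_abs, Real.norm_eq_abs, abs_of_nonneg h2]
    calc |g u| * (auxM p (t / u) / auxM p t)
        ≤ (C * (u * Real.exp (-(u / 2)))) * (1 + 8 * u ^ (-(3/2) : ℝ)) := by
          have := (abs_nonneg _).trans (hgC u hu)
          gcongr
          exact hgC u hu
      _ = _ := by
          have h3 : u ^ ((1/2:ℝ)-1) = u * u ^ (-(3/2) : ℝ) := by
            rw [← Real.rpow_one_add' hu.le (by norm_num)]; norm_num
          have h4 : u ^ ((2:ℝ)-1) = u := by norm_num
          rw [h3, h4, show -(1/2*u) = -(u/2) by ring]; ring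
  · have h := fun s : ℝ => fun hs : 0 < s => (Real.integral_rpow_mul_exp_neg_mul_Ioi (a := s) (r := 1/2) hs (by norm_num))
    have hi : ∀ s : ℝ, 0 < s → IntegrableOn (fun u : ℝ => u ^ (s-1) * Real.exp (-(1/2 * u))) (Set.Ioi 0) := by
      intro s hs
      by_contra hn
      have := h s hs
      rw [integral_undef hn] at this
      have h2 : 0 < (1 / (1/2:ℝ)) ^ s * Real.Gamma s := mul_pos (by positivity) (Real.Gamma_pos_of_pos hs)
      linarith
    exact ((hi 2 (by norm_num)).const_mul C).add ((hi (1/2) (by norm_num)).const_mul (8*C))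
  · rw [ae_restrict_iff' measurableSet_Ioi]
    refine Eventually.of_forall fun u hu => ?_
    have hu : 0 < u := hu
    have := (hM u⁻¹ (by positivity)).const_mul (g u)
    simpa only [div_eq_mul_inv, mul_comm u⁻¹] using this

end aux

section aux2
variable {p : ℕ → ℝ}

lemma aux_tail (a b : ℝ → ℝ) (ha : Measurable a)
    (hb : ∀ y, 0 < y → IntegrableOn b (Set.Ioi y)) (hbp : ∀ᶠ u in atTop, 0 < b u)
    (hB : ∀ y, 0 < y → 0 < ∫ u in Set.Ioi y, b u)
    (h : Tendsto (fun u => a u / b u) atTop (𝓝 1)) :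
    (∃ y₀ : ℝ, 0 < y₀ ∧ ∀ y : ℝ, y₀ ≤ y → IntegrableOn a (Set.Ioi y)) ∧
    Tendsto (fun y => (∫ u in Set.Ioi y, a u) / ∫ u in Set.Ioi y, b u) atTop (𝓝 1) := by
  have key : ∀ ε : ℝ, 0 < ε → ∃ y₀ : ℝ, 0 < y₀ ∧ ∀ u, y₀ ≤ u → |a u - b u| ≤ ε * b u := by
    intro ε hε
    have h1 := (Metric.tendsto_nhds.1 h ε hε).and (hbp.and (eventually_gt_atTop (0:ℝ)))
    obtain ⟨T, hT⟩ := eventually_atTop.1 h1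
    refine ⟨max T 1, by positivity, fun u hu => ?_⟩
    obtain ⟨h2, h3, h4⟩ := hT u ((le_max_left _ _).trans hu)
    rw [Real.dist_eq] at h2
    have : a u - b u = (a u / b u - 1) * b u := by field_simp
    rw [this, abs_mul, abs_of_pos h3]
    gcongr
  have hd : ∀ ε : ℝ, 0 < ε → ∃ y₀ : ℝ, 0 < y₀ ∧ ∀ y, y₀ ≤ y →
      IntegrableOn (fun u => a u - b u) (Set.Ioi y) ∧
      |∫ u in Set.Ioi y, (a u - b u)| ≤ ε * ∫ u in Set.Ioi y, b u := by
    intro ε hε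
    obtain ⟨y₀, h0, hy⟩ := key ε hε
    refine ⟨y₀, h0, fun y hyy => ?_⟩
    have hby := hb y (h0.trans_le hyy)
    have hbd : ∀ᵐ u ∂(volume.restrict (Set.Ioi y)), ‖a u - b u‖ ≤ ε * b u := by
      rw [ae_restrict_iff' measurableSet_Ioi]
      exact Eventually.of_forall fun u hu => hy u (hyy.trans (le_of_lt hu))
    refine ⟨(hby.const_mul ε).mono' (ha.aestronglyMeasurable.sub hby.aestronglyMeasurable) hbd, ?_⟩
    rw [← integral_const_mul]
    exact norm_integral_le_of_norm_le (hby.const_mul ε) hbd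
  constructor
  · obtain ⟨y₀, h0, hy⟩ := hd 1 one_pos
    refine ⟨y₀, h0, fun y hyy => ?_⟩
    have := (hy y hyy).1.add (hb y (h0.trans_le hyy))
    refine this.congr (Eventually.of_forall fun u => ?_)
    simp
  · rw [Metric.tendsto_nhds]
    intro ε hε
    obtain ⟨y₀, h0, hy⟩ := hd (ε/2) (by positivity)
    filter_upwards [eventually_ge_atTop y₀] with y hyy
    obtain ⟨h1, h2⟩ := hy y hyy
    have hb' := hb y (h0.trans_le hyy)
    have hB' := hB y (h0.trans_le hyy)
    have ha' : IntegrableOn a (Set.Ioi y) := by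
      refine (h1.add hb').congr (Eventually.of_forall fun u => ?_)
      simp
    rw [integral_sub ha' hb'] at h2
    rw [Real.dist_eq]
    have : (∫ u in Set.Ioi y, a u) / (∫ u in Set.Ioi y, b u) - 1 =
      ((∫ u in Set.Ioi y, a u) - ∫ u in Set.Ioi y, b u) / ∫ u in Set.Ioi y, b u := by
      field_simp
    rw [this, abs_div, abs_of_pos hB', div_lt_iff₀ hB']
    nlinarith

noncomputable def auxG (p : ℕ → ℝ) (y : ℝ) : ℝ := ∑' j, min (1 / y) (p j)

lemma auxG_summable (hs : Summable p) (hpos : ∀ j, 0 < p j) {y : ℝ} (hy : 0 < y) :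
    Summable (fun j => min (1 / y) (p j)) :=
  Summable.of_nonneg_of_le (fun j => le_min (by positivity) (hpos j).le)
    (fun j => min_le_right _ _) hs

lemma auxG_pos (hs : Summable p) (hpos : ∀ j, 0 < p j) {y : ℝ} (hy : 0 < y) : 0 < auxG p y :=
  (auxG_summable hs hpos hy).tsum_pos (fun j => le_min (by positivity) (hpos j).le) 0
    (lt_min (by positivity) (hpos 0))

lemma auxG_integral (hs : Summable p) (hpos : ∀ j, 0 < p j) {y : ℝ} (hy : 0 < y) :
    ∫ u in Set.Ioi y, auxM p u * u ^ (-2 : ℝ) = auxG p y := by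
  have e0 : ∀ j, (∫ u in Set.Ioi y, (Set.Ici (1 / p j)).indicator (fun u : ℝ => u ^ (-2:ℝ)) u)
      = min (1 / y) (p j) := by
    intro j
    have hp := hpos j
    rw [setIntegral_indicator measurableSet_Ici]
    have h1 : (Set.Ioi y ∩ Set.Ici (1 / p j) : Set ℝ) =ᵐ[volume] Set.Ioi (max y (1 / p j)) := by
      rw [← Set.Ioi_inter_Ioi]
      exact Filter.EventuallyEq.inter (Filter.EventuallyEq.refl _ _) Ioi_ae_eq_Ici.symm
    rw [setIntegral_congr_set h1, integral_Ioi_rpow_of_lt (by norm_num) (lt_max_of_lt_left hy)]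
    have h2 : (-2:ℝ) + 1 = -1 := by norm_num
    rw [h2, Real.rpow_neg_one]
    simp only [neg_div_neg_eq, div_one]
    rcases le_total y (1 / p j) with h | h
    · rw [max_eq_right h, min_eq_right]
      · simp
      · rw [le_div_iff₀ hp] at h
        rw [le_div_iff₀ hy]; linarith
    · rw [max_eq_left h, min_eq_left]
      · simp
      · rw [div_le_iff₀ hp] at h
        rw [div_le_iff₀ hy]; linarith
  have key := integral_tsum_of_summable_integral_norm (μ := volume.restrict (Set.Ioi y))
    (F := fun j => (Set.Ici (1 / p j)).indicator (fun u : ℝ => u ^ (-2:ℝ))) ?_ ?_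
  · simp_rw [e0] at key
    unfold auxG
    rw [key]
    apply setIntegral_congr_fun measurableSet_Ioi
    intro u hu
    have hu : 0 < u := hy.trans hu
    have := (aux_nubar hs (x := 1 / u) (by positivity)).mul_right (u ^ (-2:ℝ))
    simp only [auxM]
    rw [← this.tsum_eq]
    congr 1
    ext j
    have hp := hpos j
    have h3 : 1 / u ≤ p j ↔ 1 / p j ≤ u := by
      rw [div_le_iff₀ hu, div_le_iff₀ hp, mul_comm]
    simp only [Set.indicator, Set.mem_Ici, h3, ite_mul, one_mul, zero_mul]
  · intro j
    exact (integrableOn_Ioi_rpow_of_lt (by norm_num) hy).indicator measurableSet_Ici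
  · refine (auxG_summable hs hpos hy).congr fun j => ?_
    rw [← e0]
    apply setIntegral_congr_fun measurableSet_Ioi
    intro u hu
    have hu : 0 < u := hy.trans hu
    simp only [Set.indicator]
    split_ifs
    · exact (Real.norm_of_nonneg (by positivity)).symm
    · simp

lemma auxG_step (hs : Summable p) (hpos : ∀ j, 0 < p j) {y : ℝ} (hy : 0 < y) :
    auxG p (2 * y) + 1 / 2 * (auxM p y / y) ≤ auxG p y := by
  have h1 := (auxG_summable hs hpos (y := 2 * y) (by positivity)).hasSum
  have h2 := (auxG_summable hs hpos hy).hasSum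
  have h3 := (aux_nubar hs (x := 1 / y) (by positivity)).mul_right (1 / (2 * y))
  have := hasSum_le (fun j => ?_) (h1.add h3) h2
  · unfold auxG auxM
    have e : 1 / 2 * (nubar p (1 / y) / y) = nubar p (1 / y) * (1 / (2 * y)) := by field_simp
    rw [e]; exact this
  · have hh : 1 / (2 * y) = 1 / y / 2 := by field_simp
    have hy' : 0 < 1 / y := by positivity
    rw [hh]
    generalize 1 / y = z at *
    split_ifs with h
    · rw [min_eq_left h, min_eq_left (by linarith)]; linarith
    · push Not at h
      rw [min_eq_right h.le]
      simp

lemma auxG_diff (hs : Summable p) (hpos : ∀ j, 0 < p j) {y c : ℝ} (hy : 0 < y) (hc : 0 < c) :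
    |auxG p (c * y) - auxG p y| ≤ |1 / c - 1| * (auxM p (max 1 c * y) / y) := by
  have hm : 0 < max 1 c := by positivity
  have h1 := (auxG_summable hs hpos (y := c * y) (by positivity)).hasSum
  have h2 := (auxG_summable hs hpos hy).hasSum
  have h3 := (aux_nubar hs (x := 1 / (max 1 c * y)) (by positivity)).mul_right (|1 / c - 1| / y)
  have hb : ∀ j, |min (1 / (c * y)) (p j) - min (1 / y) (p j)| ≤
      (if 1 / (max 1 c * y) ≤ p j then (1:ℝ) else 0) * (|1 / c - 1| / y) := by
    intro j
    split_ifs with h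
    · have e : |1 / c - 1| / y = |1 / (c * y) - 1 / y| := by
        rw [show 1 / (c * y) - 1 / y = (1 / c - 1) / y by field_simp, abs_div, abs_of_pos hy]
      rw [one_mul, e]
      have := abs_min_sub_min_le_max (1 / (c * y)) (p j) (1 / y) (p j)
      simpa using this
    · push Not at h
      have h4 : p j ≤ 1 / (c * y) := h.le.trans (by gcongr; exact le_max_right _ _)
      have h5 : p j ≤ 1 / y := h.le.trans (by
        apply one_div_le_one_div_of_le hy
        have := le_max_left 1 c
        nlinarith)
      rw [min_eq_right h4, min_eq_right h5]; simp
  have u1 := hasSum_le (fun j => (abs_le.1 (hb j)).2) (h1.sub h2) h3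
  have u2 := hasSum_le (fun j => (abs_le.1 (hb j)).1) h3.neg (h1.sub h2)
  unfold auxG auxM
  have e : |1 / c - 1| * (nubar p (1 / (max 1 c * y)) / y) =
    nubar p (1 / (max 1 c * y)) * (|1 / c - 1| / y) := by ring
  rw [e, abs_le]
  exact ⟨u2, u1⟩

lemma auxG_ratio (hs : Summable p) (hpos : ∀ j, 0 < p j)
    (hM : ∀ c : ℝ, 0 < c → Tendsto (fun y => auxM p (c * y) / auxM p y) atTop (𝓝 c)) :
    Tendsto (fun y => auxM p y / (y * auxG p y)) atTop (𝓝 0) := by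
  have hH : ∀ n : ℕ, ∀ᶠ y in atTop, (n:ℝ) / 4 ≤ y * auxG p y / auxM p y := by
    intro n
    induction n with
    | zero =>
      filter_upwards [eventually_gt_atTop 0] with y hy
      have := auxG_pos hs hpos hy
      have := auxM_nonneg (p := p) y
      simp; positivity
    | succ n ih =>
      have t2 : Tendsto (fun y : ℝ => 2 * y) atTop atTop :=
        tendsto_id.const_mul_atTop (by norm_num)
      have hq := (hM 2 (by norm_num)).eventually
        (lt_mem_nhds (show 2 - 2 / ((n:ℝ) + 1) < 2 by
          have : 0 < 2 / ((n:ℝ) + 1) := by positivity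
          linarith))
      filter_upwards [t2.eventually ih, hq, auxM_pos hs (hpos 0),
        t2.eventually (auxM_pos hs (hpos 0)), eventually_gt_atTop 0] with y h1 h2 h3 h4 hy
      have hst := auxG_step hs hpos hy
      set A := auxG p (2 * y)
      set N := auxM p (2 * y)
      set q := N / auxM p y with hqd
      have e1 : 2 * y * A / N * q / 2 = y * A / auxM p y := by
        rw [hqd]; field_simp
      have e2 : y * A / auxM p y + 1 / 2 ≤ y * auxG p y / auxM p y := by
        rw [le_div_iff₀ h3]
        have : (y * A / auxM p y + 1 / 2) * auxM p y = y * (A + 1 / 2 * (auxM p y / y)) := by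
          field_simp
        rw [this]; gcongr
      have hq0 : 0 < q := div_pos h4 h3
      have e3 : (n:ℝ) / 4 * q ≤ 2 * y * A / N * q := by gcongr
      have e4 : (n:ℝ) / 4 * (2 - 2 / ((n:ℝ) + 1)) ≤ (n:ℝ) / 4 * q := by gcongr
      have e5 : (n:ℝ) / 4 * (2 - 2 / ((n:ℝ) + 1)) ≥ (n:ℝ) / 2 - 1 / 2 := by
        have : (n:ℝ) / 4 * (2 - 2 / ((n:ℝ) + 1)) = (n:ℝ) / 2 - 1 / 2 * ((n:ℝ) / ((n:ℝ) + 1)) := by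
          field_simp; ring
        rw [this]
        have : (n:ℝ) / ((n:ℝ) + 1) ≤ 1 := by
          rw [div_le_one (by positivity)]; linarith
        linarith
      push_cast
      linarith
  have hT : Tendsto (fun y => y * auxG p y / auxM p y) atTop atTop := by
    rw [tendsto_atTop]
    intro b
    obtain ⟨n, hn⟩ := exists_nat_ge (4 * b)
    filter_upwards [hH n] with y hy
    linarith
  refine hT.inv_tendsto_atTop.congr fun y => ?_
  simp

lemma auxG_slow (hs : Summable p) (hpos : ∀ j, 0 < p j)
    (hM : ∀ c : ℝ, 0 < c → Tendsto (fun y => auxM p (c * y) / auxM p y) atTop (𝓝 c)) :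
    SlowlyVarying (auxG p) := by
  intro c hc
  rw [tendsto_iff_norm_sub_tendsto_zero]
  have hm : 0 < max 1 c := by positivity
  have h := ((hM _ hm).mul (auxG_ratio hs hpos hM)).const_mul |1 / c - 1|
  rw [mul_zero, mul_zero] at h
  refine squeeze_zero' (Eventually.of_forall fun y => norm_nonneg _) ?_ h
  filter_upwards [auxM_pos hs (hpos 0), eventually_gt_atTop 0] with y h1 hy
  have hG := auxG_pos hs hpos hy
  have hd := auxG_diff hs hpos hy hc
  have e : auxG p (c * y) / auxG p y - 1 = (auxG p (c * y) - auxG p y) / auxG p y := by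
    field_simp
  rw [e, Real.norm_eq_abs, abs_div, abs_of_pos hG, div_le_iff₀ hG]
  refine hd.trans (le_of_eq ?_)
  field_simp

end aux2

section aux3
variable {p : ℕ → ℝ}

lemma aux_nuOne (hs : Summable p) (hpos : ∀ j, 0 < p j) (x : ℝ) :
    HasSum (fun j => if p j ≤ x then p j else 0) (nuOne p x) := by
  apply Summable.hasSum
  refine Summable.of_nonneg_of_le (fun j => ?_) (fun j => ?_) hs
  · split_ifs
    · exact (hpos j).le
    · exact le_rfl
  · split_ifs
    · exact le_rfl
    · exact (hpos j).le

lemma aux_nuOne_mono (hs : Summable p) (hpos : ∀ j, 0 < p j) : Monotone (nuOne p) := by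
  intro x y hxy
  refine hasSum_le (fun j => ?_) (aux_nuOne hs hpos x) (aux_nuOne hs hpos y)
  by_cases h : p j ≤ x
  · simp [h, h.trans hxy]
  · simp only [h, if_false]
    split_ifs
    · exact (hpos j).le
    · exact le_rfl

lemma aux_nuOne_pos (hs : Summable p) (hpos : ∀ j, 0 < p j) {x : ℝ} (hx : 0 < x) :
    0 < nuOne p x := by
  obtain ⟨j, hj⟩ := (hs.tendsto_atTop_zero.eventually (gt_mem_nhds hx)).exists
  refine (aux_nuOne hs hpos x).summable.tsum_pos (fun i => ?_) j ?_
  · split_ifs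
    · exact (hpos i).le
    · exact le_rfl
  · simp [hj.le, hpos j]

lemma aux_nuOne_le (hs : Summable p) (hpos : ∀ j, 0 < p j) (hsum : ∑' j, p j = 1) (x : ℝ) :
    nuOne p x ≤ 1 := by
  rw [← hsum]
  refine hasSum_le (fun j => ?_) (aux_nuOne hs hpos x) hs.hasSum
  split_ifs
  · exact le_rfl
  · exact (hpos j).le

noncomputable def auxA (p : ℕ → ℝ) (t : ℝ) : ℝ := ∑' j, p j * Real.exp (-t * p j)

lemma auxA_hasSum (hs : Summable p) (hpos : ∀ j, 0 < p j) {t : ℝ} (ht : 0 < t) :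
    HasSum (fun j => p j * Real.exp (-t * p j)) (auxA p t) := by
  apply Summable.hasSum
  refine Summable.of_nonneg_of_le (fun j => ?_) (fun j => ?_) hs
  · have := hpos j; positivity
  · have h := hpos j
    have : Real.exp (-t * p j) ≤ 1 := by
      apply Real.exp_le_one_iff.2
      nlinarith
    nlinarith

lemma auxA_pos (hs : Summable p) (hpos : ∀ j, 0 < p j) {t : ℝ} (ht : 0 < t) : 0 < auxA p t :=
  (auxA_hasSum hs hpos ht).summable.tsum_pos (fun j => by have := hpos j; positivity) 0
    (by have := hpos 0; positivity)

lemma auxA_PhiR {t : ℝ} : PhiR p 1 t = t * auxA p t := by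
  simp [PhiR, auxA]

lemma auxA_upper (hs : Summable p) (hpos : ∀ j, 0 < p j) {t a : ℝ} (ht : 0 < t) (ha : 0 < a) :
    nuOne p (1 / t) ≤ Real.exp a * auxA p (a * t) := by
  refine hasSum_le (fun j => ?_) (aux_nuOne hs hpos (1 / t))
    ((auxA_hasSum hs hpos (mul_pos ha ht)).mul_left (Real.exp a))
  have hp := hpos j
  split_ifs with h
  · rw [le_div_iff₀ ht] at h
    have : Real.exp a * (p j * Real.exp (-(a * t) * p j)) = p j * Real.exp (a * (1 - p j * t)) := by
      rw [mul_left_comm, ← Real.exp_add]; ring_nf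
    rw [this]
    have : 1 ≤ Real.exp (a * (1 - p j * t)) := Real.one_le_exp (mul_nonneg ha.le (by linarith))
    nlinarith
  · positivity

lemma auxA_lower (hs : Summable p) (hpos : ∀ j, 0 < p j) {t : ℝ} (ht : 0 < t) :
    auxA p (2 * t) - Real.exp (-1) * auxA p t ≤ (1 - Real.exp (-1)) * nuOne p (1 / t) := by
  refine hasSum_le (fun j => ?_)
    ((auxA_hasSum hs hpos (t := 2 * t) (by positivity)).sub
      ((auxA_hasSum hs hpos ht).mul_left (Real.exp (-1))))
    ((aux_nuOne hs hpos (1 / t)).mul_left (1 - Real.exp (-1)))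
  have hp := hpos j
  have e : Real.exp (-(2 * t) * p j) = Real.exp (-t * p j) * Real.exp (-t * p j) := by
    rw [← Real.exp_add]; ring_nf
  have hE := Real.exp_pos (-t * p j)
  have h1 : Real.exp (-1) < 1 := by rw [Real.exp_lt_one_iff]; norm_num
  have h2 : Real.exp (-t * p j) ≤ 1 := by
      apply Real.exp_le_one_iff.2
      nlinarith
  rw [e]
  split_ifs with h
  · have : p j * (Real.exp (-t * p j) * Real.exp (-t * p j)) - Real.exp (-1) * (p j * Real.exp (-t * p j))
      = p j * (Real.exp (-t * p j) * (Real.exp (-t * p j) - Real.exp (-1))) := by ring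
    rw [this, mul_comm (1 - Real.exp (-1)) (p j)]
    apply mul_le_mul_of_nonneg_left _ hp.le
    rw [le_div_iff₀ ht] at h
    have h3 : Real.exp (-1) ≤ Real.exp (-t * p j) := Real.exp_le_exp.2 (by nlinarith)
    nlinarith
  · push Not at h
    rw [div_lt_iff₀ ht] at h
    have h3 : Real.exp (-t * p j) ≤ Real.exp (-1) := Real.exp_le_exp.2 (by nlinarith)
    have : 0 ≤ p j * Real.exp (-t * p j) := by positivity
    nlinarith

lemma auxA_layer (hs : Summable p) (hpos : ∀ j, 0 < p j) {t : ℝ} (ht : 0 < t) :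
    auxA p t = ∫ u in Set.Ioi (0:ℝ), Real.exp (-u) * nuOne p (u / t) := by
  have e0 : ∀ j, (∫ u in Set.Ioi (0:ℝ),
      (Set.Ici (t * p j)).indicator (fun u : ℝ => p j * Real.exp (-u)) u)
      = p j * Real.exp (-t * p j) := by
    intro j
    have hp := hpos j
    have htp := mul_pos ht hp
    rw [setIntegral_indicator measurableSet_Ici]
    have h1 : (Set.Ioi 0 ∩ Set.Ici (t * p j) : Set ℝ) = Set.Ici (t * p j) := by
      apply Set.inter_eq_right.2
      intro u hu
      exact htp.trans_le hu
    rw [h1, integral_Ici_eq_integral_Ioi, integral_const_mul, integral_exp_neg_Ioi]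
    ring_nf
  have key := integral_tsum_of_summable_integral_norm (μ := volume.restrict (Set.Ioi (0:ℝ)))
    (F := fun j => (Set.Ici (t * p j)).indicator (fun u : ℝ => p j * Real.exp (-u))) ?_ ?_
  · simp_rw [e0] at key
    unfold auxA
    rw [key]
    apply setIntegral_congr_fun measurableSet_Ioi
    intro u hu
    have := (aux_nuOne hs hpos (u / t)).mul_left (Real.exp (-u))
    dsimp only
    rw [← this.tsum_eq]
    congr 1
    ext j
    have h3 : p j ≤ u / t ↔ t * p j ≤ u := by
      rw [le_div_iff₀ ht, mul_comm]
    simp only [Set.indicator, Set.mem_Ici, h3, mul_ite, mul_zero, mul_comm (p j)]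
  · intro j
    exact ((integrableOn_exp_neg_Ioi 0).const_mul _).indicator measurableSet_Ici
  · refine (auxA_hasSum hs hpos ht).summable.congr fun j => ?_
    rw [← e0]
    apply setIntegral_congr_fun measurableSet_Ioi
    intro u hu
    have := hpos j
    simp only [Set.indicator]
    split_ifs
    · exact (Real.norm_of_nonneg (by positivity)).symm
    · simp

lemma aux_nuOne_growth (hs : Summable p) (hpos : ∀ j, 0 < p j) (hsum : ∑' j, p j = 1)
    (hF : Tendsto (fun t => nuOne p (2 / t) / nuOne p (1 / t)) atTop (𝓝 1)) :
    ∃ m : ℕ, ∀ x u : ℝ, 0 < x → 0 < u → nuOne p (u * x) ≤ (1 + (2 * u) ^ m) * nuOne p x := by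
  have h1 := (hF.eventually (gt_mem_nhds (show (1:ℝ) < 2 by norm_num))).and (eventually_gt_atTop 0)
  obtain ⟨T, hT⟩ := eventually_atTop.1 h1
  have hT' : 0 < max T 1 := by positivity
  set x₀ := 1 / max T 1 with hx₀
  have hx₀p : 0 < x₀ := by positivity
  have hF0 := aux_nuOne_pos hs hpos hx₀p
  obtain ⟨m, hm⟩ := pow_unbounded_of_one_lt (max 2 (1 / nuOne p x₀)) (show (1:ℝ) < 2 by norm_num)
  have hd : ∀ x, 0 < x → nuOne p (2 * x) ≤ 2 ^ m * nuOne p x := by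
    intro x hx
    have hFx := aux_nuOne_pos hs hpos hx
    rcases le_total x x₀ with h | h
    · have h2 : T ≤ 1 / x := by
        refine (le_max_left T 1).trans ?_
        rw [le_div_iff₀ hx]
        rw [hx₀, le_div_iff₀ hT'] at h
        linarith
      have h3 := (hT _ h2).1
      rw [show 2 / (1 / x) = 2 * x by field_simp, show 1 / (1 / x) = x by field_simp,
        div_lt_iff₀ hFx] at h3
      have : (2:ℝ) ≤ 2 ^ m := (le_max_left _ _).trans hm.le
      nlinarith
    · have h2 := aux_nuOne_le hs hpos hsum (2 * x)
      have h3 := aux_nuOne_mono hs hpos h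
      have h4 : 1 / nuOne p x₀ ≤ 2 ^ m := (le_max_right _ _).trans hm.le
      rw [div_le_iff₀ hF0] at h4
      have : (0:ℝ) < 2 ^ m := by positivity
      nlinarith
  refine ⟨m, fun x u hx hu => ?_⟩
  have hFx := aux_nuOne_pos hs hpos hx
  rcases le_total u 1 with h | h
  · have h2 := aux_nuOne_mono hs hpos (show u * x ≤ x by nlinarith)
    have : 0 < (2 * u) ^ m := by positivity
    nlinarith
  · obtain ⟨k, hk1, hk2⟩ := exists_nat_pow_near h (show (1:ℝ) < 2 by norm_num)
    have hk : ∀ k : ℕ, nuOne p (2 ^ k * x) ≤ (2 ^ k) ^ m * nuOne p x := by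
      intro k
      induction k with
      | zero => simp
      | succ k ih =>
        have := hd (2 ^ k * x) (by positivity)
        rw [pow_succ', mul_pow, mul_assoc, mul_assoc]
        refine this.trans ?_
        gcongr
    have h2 := aux_nuOne_mono hs hpos (show u * x ≤ 2 ^ (k+1) * x by gcongr)
    have h3 := hk (k+1)
    have h4 : ((2:ℝ) ^ (k+1)) ^ m ≤ (2 * u) ^ m := by
      gcongr
      rw [pow_succ']; gcongr
    nlinarith [mul_le_mul_of_nonneg_right h4 hFx.le]

lemma aux_abel (hs : Summable p) (hpos : ∀ j, 0 < p j) (hsum : ∑' j, p j = 1)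
    (hF : ∀ u : ℝ, 0 < u → Tendsto (fun t => nuOne p (u / t) / nuOne p (1 / t)) atTop (𝓝 1)) :
    Tendsto (fun t => auxA p t / nuOne p (1 / t)) atTop (𝓝 1) := by
  obtain ⟨m, hm⟩ := aux_nuOne_growth hs hpos hsum (hF 2 (by norm_num))
  have e : ∀ᶠ t in atTop, ∫ u in Set.Ioi (0:ℝ), Real.exp (-u) * (nuOne p (u / t) / nuOne p (1 / t)) =
      auxA p t / nuOne p (1 / t) := by
    filter_upwards [eventually_gt_atTop 0] with t ht
    rw [auxA_layer hs hpos ht, ← integral_div]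
    congr 1; ext u; ring
  refine Tendsto.congr' e ?_
  have h1 : ∫ u in Set.Ioi (0:ℝ), Real.exp (-u) * 1 = 1 := by
    simp only [mul_one]
    rw [integral_exp_neg_Ioi]; simp
  suffices H : Tendsto (fun t => ∫ u in Set.Ioi (0:ℝ),
      Real.exp (-u) * (nuOne p (u / t) / nuOne p (1 / t))) atTop
      (𝓝 (∫ u in Set.Ioi (0:ℝ), Real.exp (-u) * 1)) by rwa [h1] at H
  apply tendsto_integral_filter_of_dominated_convergence
    (fun u => Real.exp (-u) + 2 ^ m * (Real.exp (-u) * u ^ (((m:ℝ) + 1) - 1)))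
  · refine Eventually.of_forall fun t => ?_
    apply AEStronglyMeasurable.mul (by fun_prop)
    apply Measurable.aestronglyMeasurable
    apply Measurable.div_const
    exact (aux_nuOne_mono hs hpos).measurable.comp (measurable_id.div_const t)
  · filter_upwards [eventually_gt_atTop 0] with t ht
    rw [ae_restrict_iff' measurableSet_Ioi]
    refine Eventually.of_forall fun u hu => ?_
    have hu : 0 < u := hu
    have hp := aux_nuOne_pos hs hpos (show 0 < 1 / t by positivity)
    have h2 := aux_nuOne_pos hs hpos (show 0 < u / t by positivity)
    rw [Real.norm_of_nonneg (by positivity)]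
    have h3 : nuOne p (u / t) / nuOne p (1 / t) ≤ 1 + (2 * u) ^ m := by
      rw [div_le_iff₀ hp]
      have := hm (1 / t) u (by positivity) hu
      rwa [mul_one_div] at this
    calc _ ≤ Real.exp (-u) * (1 + (2 * u) ^ m) := by gcongr
      _ = _ := by
        rw [add_sub_cancel_right, Real.rpow_natCast, mul_pow]; ring
  · exact (integrableOn_exp_neg_Ioi 0).add
      ((Real.GammaIntegral_convergent (by positivity)).const_mul _)
  · rw [ae_restrict_iff' measurableSet_Ioi]
    exact Eventually.of_forall fun u hu => (hF u hu).const_mul _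

lemma aux_tauber (hs : Summable p) (hpos : ∀ j, 0 < p j)
    (hA : ∀ a : ℝ, 0 < a → Tendsto (fun t => auxA p (a * t) / auxA p t) atTop (𝓝 1)) :
    Tendsto (fun t => nuOne p (1 / t) / auxA p t) atTop (𝓝 1) := by
  have h1 : Real.exp (-1) < 1 := by rw [Real.exp_lt_one_iff]; norm_num
  rw [tendsto_order]
  constructor
  · intro b hb
    have h2 := ((hA 2 (by norm_num)).sub_const (Real.exp (-1))).div_const (1 - Real.exp (-1))
    rw [div_self (by linarith)] at h2
    filter_upwards [h2.eventually (lt_mem_nhds hb), eventually_gt_atTop 0] with t h3 ht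
    refine h3.trans_le ?_
    have hp := auxA_pos hs hpos ht
    have := auxA_lower hs hpos ht
    rw [div_le_iff₀ (by linarith), ← sub_nonneg]
    have e : nuOne p (1 / t) / auxA p t * (1 - Real.exp (-1)) - (auxA p (2 * t) / auxA p t - Real.exp (-1))
      = ((1 - Real.exp (-1)) * nuOne p (1 / t) - (auxA p (2 * t) - Real.exp (-1) * auxA p t)) / auxA p t := by
      field_simp
    rw [e]
    exact div_nonneg (by linarith) hp.le
  · intro b hb
    have hl := Real.log_pos hb
    have h2 := (hA (Real.log b / 2) (by positivity)).const_mul (Real.exp (Real.log b / 2))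
    have h3 : Real.exp (Real.log b / 2) * 1 < b := by
      rw [mul_one]
      calc _ < Real.exp (Real.log b) := Real.exp_lt_exp.2 (by linarith)
        _ = b := Real.exp_log (by linarith)
    filter_upwards [h2.eventually (gt_mem_nhds h3), eventually_gt_atTop 0] with t h4 ht
    refine lt_of_le_of_lt ?_ h4
    have hp := auxA_pos hs hpos ht
    rw [← mul_div_assoc]
    gcongr
    exact auxA_upper hs hpos ht (by positivity)

lemma aux_part2 (hs : Summable p) (hpos : ∀ j, 0 < p j) (hsum : ∑' j, p j = 1)
    (ℓ₁ : ℝ → ℝ) (hl : ∀ y : ℝ, 0 < y → 0 < ℓ₁ y) (hsv : SlowlyVarying ℓ₁) :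
      (Tendsto (fun x : ℝ => nuOne p x / ℓ₁ (1 / x)) (𝓝[>] 0) (𝓝 1) ↔
        Tendsto (fun t : ℝ => PhiR p 1 t / (t * ℓ₁ t)) atTop (𝓝 1)) := by
  have hR : Tendsto (fun t : ℝ => PhiR p 1 t / (t * ℓ₁ t)) atTop (𝓝 1) ↔
      Tendsto (fun t : ℝ => auxA p t / ℓ₁ t) atTop (𝓝 1) := by
    apply tendsto_congr'
    filter_upwards [eventually_gt_atTop 0] with t ht
    rw [auxA_PhiR, mul_div_mul_left _ _ ht.ne']
  have hL : Tendsto (fun x : ℝ => nuOne p x / ℓ₁ (1 / x)) (𝓝[>] 0) (𝓝 1) ↔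
      Tendsto (fun t : ℝ => nuOne p (1 / t) / ℓ₁ t) atTop (𝓝 1) := by
    constructor
    · intro h
      refine (h.comp tendsto_inv_atTop_nhdsGT_zero).congr fun t => ?_
      simp
    · intro h
      refine (h.comp tendsto_inv_nhdsGT_zero).congr fun t => ?_
      simp
  rw [hR, hL]
  constructor
  · intro h
    have hF : ∀ u : ℝ, 0 < u →
        Tendsto (fun t => nuOne p (u / t) / nuOne p (1 / t)) atTop (𝓝 1) := by
      intro u hu
      have tu : Tendsto (fun t : ℝ => u⁻¹ * t) atTop atTop :=
        tendsto_id.const_mul_atTop (by positivity)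
      have := ((h.comp tu).mul (hsv u⁻¹ (by positivity))).div h one_ne_zero
      simp only [mul_one, div_one] at this
      refine this.congr' ?_
      filter_upwards [eventually_gt_atTop 0] with t ht
      have a1 := hl t ht
      have a2 := hl (u⁻¹ * t) (by positivity)
      have a3 := aux_nuOne_pos hs hpos (show 0 < 1 / t by positivity)
      have e : 1 / (u⁻¹ * t) = u / t := by field_simp
      simp only [Pi.div_apply, Function.comp, e]
      generalize ℓ₁ (u⁻¹ * t) = z at *
      field_simp
    have := (aux_abel hs hpos hsum hF).mul h
    simp only [mul_one] at this
    refine this.congr' ?_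
    filter_upwards [eventually_gt_atTop 0] with t ht
    have a3 := aux_nuOne_pos hs hpos (show 0 < 1 / t by positivity)
    field_simp
  · intro h
    have hA : ∀ u : ℝ, 0 < u →
        Tendsto (fun t => auxA p (u * t) / auxA p t) atTop (𝓝 1) := by
      intro u hu
      have tu : Tendsto (fun t : ℝ => u * t) atTop atTop :=
        tendsto_id.const_mul_atTop (by positivity)
      have := ((h.comp tu).mul (hsv u (by positivity))).div h one_ne_zero
      simp only [mul_one, div_one] at this
      refine this.congr' ?_
      filter_upwards [eventually_gt_atTop 0] with t ht
      have a1 := hl t ht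
      have a2 := hl (u * t) (by positivity)
      have a3 := auxA_pos hs hpos ht
      simp only [Pi.div_apply, Function.comp]
      field_simp
    have := (aux_tauber hs hpos hA).mul h
    simp only [mul_one] at this
    refine this.congr' ?_
    filter_upwards [eventually_gt_atTop 0] with t ht
    have a3 := auxA_pos hs hpos ht
    field_simp

end aux3

section aux4
variable {p : ℕ → ℝ}

lemma aux_k1 {x : ℝ} : 1 - Real.exp (-x) ≤ min 1 x := by
  refine le_min ?_ ?_
  · linarith [Real.exp_pos (-x)]
  · linarith [Real.add_one_le_exp (-x)]

lemma aux_k2 {x : ℝ} (hx : 0 < x) :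
    min 1 x ≤ (1 - Real.exp (-x)) + 3 * (1 - Real.exp (-x) - x * Real.exp (-x)) := by
  have hq := Real.quadratic_le_exp_of_nonneg hx.le
  have hE : Real.exp (-x) ≤ 1 / (1 + x + x ^ 2 / 2) := by
    rw [Real.exp_neg, ← one_div]
    exact one_div_le_one_div_of_le (by positivity) hq
  have h4 : (4 + 3 * x) * Real.exp (-x) ≤ (4 + 3 * x) / (1 + x + x ^ 2 / 2) := by
    rw [← mul_one_div]; gcongr
  have hq0 : 0 < 1 + x + x ^ 2 / 2 := by positivity
  rcases le_total 1 x with h | h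
  · rw [min_eq_left h]
    have : (4 + 3 * x) / (1 + x + x ^ 2 / 2) ≤ 3 := by
      rw [div_le_iff₀ hq0]; nlinarith
    linarith
  · rw [min_eq_right h]
    have : (4 + 3 * x) / (1 + x + x ^ 2 / 2) ≤ 4 - x := by
      rw [div_le_iff₀ hq0]
      have : 0 ≤ x ^ 2 * (1 - x / 2) := by
        apply mul_nonneg (by positivity); linarith
      nlinarith
    linarith

lemma aux_powexp (n : ℕ) {u : ℝ} (hu : 0 < u) :
    u ^ n * Real.exp (-u) ≤ 2 ^ n * n.factorial * Real.exp (-(u/2)) := by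
  have h := Real.pow_div_factorial_le_exp (u/2) (by positivity) n
  rw [div_le_iff₀ (by positivity), div_pow, div_le_iff₀ (by positivity)] at h
  have e : Real.exp (-(u/2)) = Real.exp (u/2) * Real.exp (-u) := by
    rw [← Real.exp_add]; ring_nf
  rw [e]
  have := mul_le_mul_of_nonneg_right h (Real.exp_pos (-u)).le
  linarith

lemma aux_Phi_summable (hs : Summable p) (hpos : ∀ j, 0 < p j) {t : ℝ} (ht : 0 < t) :
    Summable (fun j => 1 - Real.exp (-t * p j)) := by
  refine Summable.of_nonneg_of_le (fun j => ?_) (fun j => ?_) (hs.mul_left t)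
  · have h := hpos j
    have : Real.exp (-t * p j) ≤ 1 := by
      apply Real.exp_le_one_iff.2
      nlinarith
    linarith
  · linarith [Real.add_one_le_exp (-t * p j)]

lemma aux_Phi_diff (hs : Summable p) (hpos : ∀ j, 0 < p j) {t : ℝ} (ht : 0 < t) :
    HasSum (fun j => 1 - Real.exp (-(t * p j)) - (t * p j) * Real.exp (-(t * p j)))
      (Phi p t - PhiR p 1 t) := by
  have h := (aux_Phi_summable hs hpos ht).hasSum.sub ((auxA_hasSum hs hpos ht).mul_left t)
  rw [auxA_PhiR]
  unfold Phi
  have e : (fun j => 1 - Real.exp (-(t * p j)) - (t * p j) * Real.exp (-(t * p j))) =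
      fun j => 1 - Real.exp (-t * p j) - t * (p j * Real.exp (-t * p j)) := by
    funext j
    rw [show -(t * p j) = -t * p j by ring]; ring
  rw [e]; exact h

lemma aux_Phi_lim (hs : Summable p) (hpos : ∀ j, 0 < p j)
    (hM : ∀ c : ℝ, 0 < c → Tendsto (fun y => auxM p (c * y) / auxM p y) atTop (𝓝 c)) :
    Tendsto (fun t => (Phi p t - PhiR p 1 t) / (t * auxG p t)) atTop (𝓝 0) := by
  have h := aux_A hs hpos hM (fun u => u * Real.exp (-u))
    (fun x => 1 - Real.exp (-x) - x * Real.exp (-x)) (by fun_prop) 1 ?_ ?_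
  · have h2 := h.mul (auxG_ratio hs hpos hM)
    rw [mul_zero] at h2
    refine h2.congr' ?_
    filter_upwards [eventually_gt_atTop 0, auxM_pos hs (hpos 0)] with t ht hm
    have := auxG_pos hs hpos ht
    rw [(aux_Phi_diff hs hpos ht).tsum_eq]
    field_simp
  · intro u hu
    rw [abs_of_pos (by positivity), one_mul]
    have : Real.exp (-u) ≤ Real.exp (-(u/2)) := Real.exp_le_exp.2 (by linarith)
    gcongr
  · intro x hx
    rw [← intervalIntegral.integral_of_le hx.le,
      intervalIntegral.integral_eq_sub_of_hasDerivAt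
        (f := fun x => 1 - Real.exp (-x) - x * Real.exp (-x))]
    · simp
    · intro u _
      have h1 : HasDerivAt (fun u : ℝ => Real.exp (-u)) (-Real.exp (-u)) u := by
        simpa using (hasDerivAt_neg u).exp
      have := (h1.const_sub 1).sub ((hasDerivAt_id u).mul h1)
      refine this.congr_deriv ?_
      simp
    · apply Continuous.intervalIntegrable; fun_prop

lemma aux_tG (hs : Summable p) (hpos : ∀ j, 0 < p j) {t : ℝ} (ht : 0 < t) :
    HasSum (fun j => min 1 (t * p j)) (t * auxG p t) := by
  have := (auxG_summable hs hpos ht).hasSum.mul_left t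
  have e : (fun j => min 1 (t * p j)) = fun j => t * min (1 / t) (p j) := by
    funext j
    rw [mul_min_of_nonneg _ _ ht.le, mul_one_div_cancel ht.ne']
  rw [e]; exact this

lemma aux_sand1 (hs : Summable p) (hpos : ∀ j, 0 < p j) {t : ℝ} (ht : 0 < t) :
    Phi p t ≤ t * auxG p t := by
  refine hasSum_le (fun j => ?_) (aux_Phi_summable hs hpos ht).hasSum (aux_tG hs hpos ht)
  rw [neg_mul]; exact aux_k1

lemma aux_sand2 (hs : Summable p) (hpos : ∀ j, 0 < p j) {t : ℝ} (ht : 0 < t) :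
    t * auxG p t ≤ Phi p t + 3 * (Phi p t - PhiR p 1 t) := by
  refine hasSum_le (fun j => ?_) (aux_tG hs hpos ht)
    ((aux_Phi_summable hs hpos ht).hasSum.add ((aux_Phi_diff hs hpos ht).mul_left 3))
  rw [neg_mul]; exact aux_k2 (mul_pos ht (hpos j))

lemma aux_sand3 (hs : Summable p) (hpos : ∀ j, 0 < p j) {t : ℝ} (ht : 0 < t) :
    0 ≤ Phi p t - PhiR p 1 t := by
  linarith [aux_sand1 hs hpos ht, aux_sand2 hs hpos ht]

lemma aux_Phi_G (hs : Summable p) (hpos : ∀ j, 0 < p j)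
    (hM : ∀ c : ℝ, 0 < c → Tendsto (fun y => auxM p (c * y) / auxM p y) atTop (𝓝 c)) :
    Tendsto (fun t => Phi p t / (t * auxG p t)) atTop (𝓝 1) := by
  have h := ((aux_Phi_lim hs hpos hM).const_mul 3).const_sub 1
  rw [mul_zero, sub_zero] at h
  refine tendsto_of_tendsto_of_tendsto_of_le_of_le' h tendsto_const_nhds ?_ ?_
  · filter_upwards [eventually_gt_atTop 0] with t ht
    have hG := mul_pos ht (auxG_pos hs hpos ht)
    have := aux_sand2 hs hpos ht
    rw [le_div_iff₀ hG]
    have e : (1 - 3 * ((Phi p t - PhiR p 1 t) / (t * auxG p t))) * (t * auxG p t) =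
      t * auxG p t - 3 * (Phi p t - PhiR p 1 t) := by
      rw [sub_mul, mul_assoc, div_mul_cancel₀ _ hG.ne', one_mul]
    rw [e]; linarith
  · filter_upwards [eventually_gt_atTop 0] with t ht
    have hG := mul_pos ht (auxG_pos hs hpos ht)
    rw [div_le_one hG]
    exact aux_sand1 hs hpos ht

lemma aux_Phi1_G (hs : Summable p) (hpos : ∀ j, 0 < p j)
    (hM : ∀ c : ℝ, 0 < c → Tendsto (fun y => auxM p (c * y) / auxM p y) atTop (𝓝 c)) :
    Tendsto (fun t => PhiR p 1 t / (t * auxG p t)) atTop (𝓝 1) := by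
  have h := (aux_Phi_G hs hpos hM).sub (aux_Phi_lim hs hpos hM)
  rw [sub_zero] at h
  refine h.congr fun t => ?_
  ring

lemma aux_gamma_int (n : ℕ) :
    IntegrableOn (fun u : ℝ => u ^ n * Real.exp (-u)) (Set.Ioi 0) ∧
    ∫ u in Set.Ioi (0:ℝ), u ^ n * Real.exp (-u) = n.factorial := by
  have e : (fun u : ℝ => u ^ n * Real.exp (-u)) =
      fun u : ℝ => Real.exp (-u) * u ^ (((n:ℝ) + 1) - 1) := by
    ext u
    rw [add_sub_cancel_right, Real.rpow_natCast, mul_comm]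
  rw [e]
  refine ⟨Real.GammaIntegral_convergent (by positivity), ?_⟩
  rw [← Real.Gamma_eq_integral (by positivity), Real.Gamma_nat_eq_factorial]

lemma aux_PhiR_lim (hs : Summable p) (hpos : ∀ j, 0 < p j)
    (hM : ∀ c : ℝ, 0 < c → Tendsto (fun y => auxM p (c * y) / auxM p y) atTop (𝓝 c)) (n : ℕ) :
    Tendsto (fun t => (∑' j, (t * p j) ^ (n+2) * Real.exp (-(t * p j))) / auxM p t) atTop
      (𝓝 (n.factorial : ℝ)) := by
  have h := aux_A hs hpos hM
    (fun u => ((n+2:ℝ) * u ^ (n+1) - u ^ (n+2)) * Real.exp (-u))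
    (fun x => x ^ (n+2) * Real.exp (-x)) (by fun_prop)
    ((n+2) * (2 ^ n * n.factorial) + 2 ^ (n+1) * (n+1).factorial) ?_ ?_
  · convert h using 2
    have e : ∫ u in Set.Ioi (0:ℝ), ((n+2:ℝ) * u ^ (n+1) - u ^ (n+2)) * Real.exp (-u) / u =
        ∫ u in Set.Ioi (0:ℝ), ((n+2:ℝ) * (u ^ n * Real.exp (-u)) - u ^ (n+1) * Real.exp (-u)) := by
      apply setIntegral_congr_fun measurableSet_Ioi
      intro u hu
      have hu : 0 < u := hu
      dsimp only
      field_simp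
      ring
    rw [e, integral_sub ((aux_gamma_int n).1.const_mul _) (aux_gamma_int (n+1)).1,
      integral_const_mul, (aux_gamma_int n).2, (aux_gamma_int (n+1)).2, Nat.factorial_succ]
    push_cast; ring
  · intro u hu
    have h1 := aux_powexp n hu
    have h2 := aux_powexp (n+1) hu
    have e : ((n+2:ℝ) * u ^ (n+1) - u ^ (n+2)) * Real.exp (-u) =
      u * ((n+2:ℝ) * (u ^ n * Real.exp (-u)) - u ^ (n+1) * Real.exp (-u)) := by ring
    have h3 : 0 < u ^ n * Real.exp (-u) := by positivity
    have h4 : 0 < u ^ (n+1) * Real.exp (-u) := by positivity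
    rw [e, abs_mul, abs_of_pos hu]
    have h5 : |(n+2:ℝ) * (u ^ n * Real.exp (-u)) - u ^ (n+1) * Real.exp (-u)| ≤
      (n+2:ℝ) * (u ^ n * Real.exp (-u)) + u ^ (n+1) * Real.exp (-u) := by
      rw [abs_le]
      have : 0 < (n+2:ℝ) * (u ^ n * Real.exp (-u)) := by positivity
      constructor <;> linarith
    calc _ ≤ u * ((n+2:ℝ) * (u ^ n * Real.exp (-u)) + u ^ (n+1) * Real.exp (-u)) := by gcongr
      _ ≤ u * ((n+2:ℝ) * (2 ^ n * n.factorial * Real.exp (-(u/2)))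
            + 2 ^ (n+1) * (n+1).factorial * Real.exp (-(u/2))) := by gcongr
      _ = _ := by ring
  · intro x hx
    rw [← intervalIntegral.integral_of_le hx.le,
      intervalIntegral.integral_eq_sub_of_hasDerivAt
        (f := fun x => x ^ (n+2) * Real.exp (-x))]
    · simp
    · intro u _
      have h1 : HasDerivAt (fun u : ℝ => Real.exp (-u)) (-Real.exp (-u)) u := by
        simpa using (hasDerivAt_neg u).exp
      have := (hasDerivAt_pow (n+2) u).mul h1
      refine this.congr_deriv ?_
      simp only [Nat.add_succ_sub_one]
      push_cast
      ring
    · apply Continuous.intervalIntegrable; fun_prop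

lemma aux_part1 (hs : Summable p) (hpos : ∀ j, 0 < p j) (ℓ : ℝ → ℝ) (hmeas : Measurable ℓ)
    (hl : ∀ y : ℝ, 0 < y → 0 < ℓ y) (hsv : SlowlyVarying ℓ)
    (hN : Tendsto (fun x : ℝ => nubar p x / (x⁻¹ * ℓ (1 / x))) (𝓝[>] 0) (𝓝 1)) :
      (∃ y₀ : ℝ, 0 < y₀ ∧ ∀ y : ℝ, y₀ ≤ y →
        IntegrableOn (fun u : ℝ => ℓ u / u) (Set.Ioi y)) ∧
      SlowlyVarying (ellOne ℓ) ∧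
      Tendsto (fun t : ℝ => Phi p t / (t * ellOne ℓ t)) atTop (𝓝 1) ∧
      Tendsto (fun t : ℝ => PhiR p 1 t / (t * ellOne ℓ t)) atTop (𝓝 1) ∧
      (∀ r : ℕ, 1 < r →
        Tendsto
          (fun t : ℝ => PhiR p r t / (1 / ((r : ℝ) * ((r : ℝ) - 1)) * t * ℓ t))
          atTop (𝓝 1)) := by
  have hML : Tendsto (fun y => auxM p y / (y * ℓ y)) atTop (𝓝 1) := by
    refine (hN.comp tendsto_inv_atTop_nhdsGT_zero).congr fun t => ?_
    simp [auxM]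
  have hM : ∀ c : ℝ, 0 < c → Tendsto (fun y => auxM p (c * y) / auxM p y) atTop (𝓝 c) := by
    intro c hc
    have tu : Tendsto (fun t : ℝ => c * t) atTop atTop :=
      tendsto_id.const_mul_atTop hc
    have := (((hML.comp tu).mul (hsv c hc)).div hML one_ne_zero).const_mul c
    simp only [mul_one, div_one] at this
    refine this.congr' ?_
    filter_upwards [eventually_gt_atTop 0, auxM_pos hs (hpos 0)] with t ht hm
    have a1 := hl t ht
    have a2 := hl (c * t) (by positivity)
    simp only [Pi.div_apply, Function.comp]
    field_simp
  have hGi := fun y (hy : 0 < y) => auxG_integral hs hpos hy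
  have hGp := fun y (hy : 0 < y) => auxG_pos hs hpos hy
  have htail := aux_tail (fun u => ℓ u / u) (fun u => auxM p u * u ^ (-2:ℝ))
    (hmeas.div measurable_id) ?_ ?_ ?_ ?_
  rotate_left
  · intro y hy
    by_contra hn
    have h1 := hGi y hy
    rw [integral_undef hn] at h1
    exact (hGp y hy).ne h1
  · filter_upwards [eventually_gt_atTop 0, auxM_pos hs (hpos 0)] with t ht hm
    positivity
  · intro y hy
    rw [hGi y hy]; exact hGp y hy
  · have := hML.inv₀ one_ne_zero
    rw [inv_one] at this
    refine this.congr' ?_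
    filter_upwards [eventually_gt_atTop 0, auxM_pos hs (hpos 0)] with t ht hm
    rw [Real.rpow_neg ht.le, Real.rpow_two]
    field_simp
  obtain ⟨hint, hlim⟩ := htail
  have hE : Tendsto (fun y => ellOne ℓ y / auxG p y) atTop (𝓝 1) := by
    refine hlim.congr' ?_
    filter_upwards [eventually_gt_atTop 0] with y hy
    rw [hGi y hy]; rfl
  have hEp : ∀ᶠ y in atTop, 0 < ellOne ℓ y := by
    filter_upwards [hE.eventually (lt_mem_nhds (show (0:ℝ) < 1 by norm_num)),
      eventually_gt_atTop 0] with y h1 hy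
    have := hGp y hy
    by_contra hn
    push Not at hn
    exact absurd h1 (not_lt.2 (div_nonpos_of_nonpos_of_nonneg hn this.le))
  refine ⟨hint, ?_, ?_, ?_, ?_⟩
  · intro c hc
    have tu : Tendsto (fun t : ℝ => c * t) atTop atTop :=
      tendsto_id.const_mul_atTop hc
    have := ((hE.comp tu).mul (auxG_slow hs hpos hM c hc)).div hE one_ne_zero
    simp only [mul_one, div_one] at this
    refine this.congr' ?_
    filter_upwards [eventually_gt_atTop 0, hEp] with t ht hm
    have a1 := hGp t ht
    have a2 := hGp (c * t) (by positivity)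
    simp only [Pi.div_apply, Function.comp]
    field_simp
  · have := (aux_Phi_G hs hpos hM).div hE one_ne_zero
    simp only [div_one] at this
    refine this.congr' ?_
    filter_upwards [eventually_gt_atTop 0, hEp] with t ht hm
    have a1 := hGp t ht
    simp only [Pi.div_apply]
    field_simp
  · have := (aux_Phi1_G hs hpos hM).div hE one_ne_zero
    simp only [div_one] at this
    refine this.congr' ?_
    filter_upwards [eventually_gt_atTop 0, hEp] with t ht hm
    have a1 := hGp t ht
    simp only [Pi.div_apply]
    field_simp
  · intro r hr
    obtain ⟨n, rfl⟩ : ∃ n, r = n + 2 := ⟨r - 2, by omega⟩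
    have := ((aux_PhiR_lim hs hpos hM n).mul hML).div_const (n.factorial : ℝ)
    rw [mul_one, div_self (by positivity)] at this
    refine this.congr' ?_
    filter_upwards [eventually_gt_atTop 0, auxM_pos hs (hpos 0)] with t ht hm
    have a1 := hl t ht
    have e : PhiR p (n+2) t = (∑' j, (t * p j) ^ (n+2) * Real.exp (-(t * p j))) /
        ((n+2).factorial : ℝ) := by
      unfold PhiR
      rw [div_mul_eq_mul_div, ← tsum_mul_left]
      congr 2
      ext j
      rw [mul_pow, neg_mul]; ring
    rw [e]
    have e2 : ((n+2).factorial : ℝ) = (n+2) * ((n+1) * n.factorial) := by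
      rw [Nat.factorial_succ, Nat.factorial_succ]; push_cast; ring
    have e3 : ((n + 2 : ℕ) : ℝ) * (((n + 2 : ℕ) : ℝ) - 1) = (n+2) * (n+1) := by
      push_cast; ring
    rw [e2, e3]
    field_simp

end aux4

/-- Rapid variation: if `ν̄(x) ∼ x^{-1} ℓ(1/x)`, then with
`ℓ_1(y) = ∫_y^∞ u^{-1} ℓ(u) du` (convergent for large `y`, slowly varying),
`Φ(t) ∼ Φ_1(t) ∼ t ℓ_1(t)`, and `Φ_r(t) ∼ (1/(r(r−1))) t ℓ(t)` for `r > 1`.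
Moreover, for any slowly varying `ℓ_1`, `ν_1[0,x] ∼ ℓ_1(1/x)` (x → 0+) iff
`Φ_1(t) ∼ t ℓ_1(t)` (t → ∞). -/
theorem stmt_18 (p : ℕ → ℝ) (hpos : ∀ j, 0 < p j) (hmono : Antitone p)
    (hsum : ∑' j, p j = 1) :
    (∀ ℓ : ℝ → ℝ, Measurable ℓ → (∀ y : ℝ, 0 < y → 0 < ℓ y) → SlowlyVarying ℓ →
      Tendsto (fun x : ℝ => nubar p x / (x⁻¹ * ℓ (1 / x))) (𝓝[>] 0) (𝓝 1) →
      (∃ y₀ : ℝ, 0 < y₀ ∧ ∀ y : ℝ, y₀ ≤ y →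
        IntegrableOn (fun u : ℝ => ℓ u / u) (Set.Ioi y)) ∧
      SlowlyVarying (ellOne ℓ) ∧
      Tendsto (fun t : ℝ => Phi p t / (t * ellOne ℓ t)) atTop (𝓝 1) ∧
      Tendsto (fun t : ℝ => PhiR p 1 t / (t * ellOne ℓ t)) atTop (𝓝 1) ∧
      (∀ r : ℕ, 1 < r →
        Tendsto
          (fun t : ℝ => PhiR p r t / (1 / ((r : ℝ) * ((r : ℝ) - 1)) * t * ℓ t))
          atTop (𝓝 1))) ∧
    (∀ ℓ₁ : ℝ → ℝ, (∀ y : ℝ, 0 < y → 0 < ℓ₁ y) → SlowlyVarying ℓ₁ →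
      (Tendsto (fun x : ℝ => nuOne p x / ℓ₁ (1 / x)) (𝓝[>] 0) (𝓝 1) ↔
        Tendsto (fun t : ℝ => PhiR p 1 t / (t * ℓ₁ t)) atTop (𝓝 1))) := by
  have hs := aux_summable hsum
  exact ⟨fun ℓ h1 h2 h3 h4 => aux_part1 hs hpos ℓ h1 h2 h3 h4,
    fun ℓ₁ h1 h2 => aux_part2 hs hpos hsum ℓ₁ h1 h2⟩
end
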